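/- arXiv:2007.03507 — 2 statements merged into one kernel-verified Lean document; each statement's English description precedes it below -/
import Mathlib

section
/- Let Q be a totally unimodular matrix, and let f ≤ g be integer-valued bounding vectors of appropriate dimension, where f may have −∞ and g may have +∞ components. Then the polyhedron R' := {z : z = Qx for some x with f ≤ x ≤ g} is box-TDI. Analogously, if ℓ ≤ u are integer-valued bounding vectors (ℓ possibly with −∞ and u possibly with +∞ components), then the polyhedron R'' := {w : w = yQ for some y with ℓ ≤ y ≤ u} is box-TDI. -/
open Matrix

/-- A rational linear system `A x ≥ b` is totally dual integral (TDI): for every integral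
cost vector `c` for which the dual program `max {y b : y ≥ 0, y A = c}` is feasible and
bounded, the maximum is attained by an integral vector `y`. -/
def IsTDI {ι κ : Type} [Fintype ι] [Fintype κ] (A : Matrix ι κ ℚ) (b : ι → ℚ) : Prop :=
  ∀ c : κ → ℤ,
    (∃ y : ι → ℚ, 0 ≤ y ∧ y ᵥ* A = fun j => (c j : ℚ)) →
    (∃ M : ℚ, ∀ y : ι → ℚ, 0 ≤ y → (y ᵥ* A = fun j => (c j : ℚ)) → y ⬝ᵥ b ≤ M) →
    ∃ y : ι → ℚ, (∀ i, ∃ z : ℤ, y i = z) ∧ 0 ≤ y ∧ (y ᵥ* A = fun j => (c j : ℚ)) ∧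
      ∀ y' : ι → ℚ, 0 ≤ y' → (y' ᵥ* A = fun j => (c j : ℚ)) → y' ⬝ᵥ b ≤ y ⬝ᵥ b

/-- The coefficient matrix of the system `[A x ≥ b, x ≥ f, -x ≥ -g]`. -/
def boxMatrix {ι κ : Type} [DecidableEq κ] (A : Matrix ι κ ℚ) : Matrix (ι ⊕ (κ ⊕ κ)) κ ℚ :=
  Matrix.of fun i j =>
    match i with
    | Sum.inl i => A i j
    | Sum.inr (Sum.inl i) => if i = j then 1 else 0
    | Sum.inr (Sum.inr i) => if i = j then -1 else 0

/-- The right-hand side of the system `[A x ≥ b, x ≥ f, -x ≥ -g]`. -/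
def boxRHS {ι κ : Type} (b : ι → ℚ) (f g : κ → ℚ) : ι ⊕ (κ ⊕ κ) → ℚ :=
  Sum.elim b (Sum.elim f fun j => -(g j))

/-- A rational linear system `A x ≥ b` is box-TDI: for all rational finite-valued
bounding vectors `f ≤ g`, the system `[A x ≥ b, f ≤ x ≤ g]` is TDI. -/
def IsBoxTDI {ι κ : Type} [Fintype ι] [Fintype κ] [DecidableEq κ]
    (A : Matrix ι κ ℚ) (b : ι → ℚ) : Prop :=
  ∀ f g : κ → ℚ, f ≤ g → IsTDI (boxMatrix A) (boxRHS b f g)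

/-- A box-TDI polyhedron: one that can be described by a box-TDI inequality system. -/
def IsBoxTDIPolyhedron {κ : Type} [Fintype κ] [DecidableEq κ] (R : Set (κ → ℚ)) : Prop :=
  ∃ (m : ℕ) (A : Matrix (Fin m) κ ℚ) (b : Fin m → ℚ),
    R = {x | b ≤ A *ᵥ x} ∧ IsBoxTDI A b

/-- The integers as a subring of `ℚ`. -/
abbrev ratIntegers : Subring ℚ := (Int.castRingHom ℚ).range

theorem mem_ratIntegers {x : ℚ} : x ∈ ratIntegers ↔ ∃ z : ℤ, x = z := by
  simp [ratIntegers, RingHom.mem_range, eq_comm]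

theorem integral_of_unimodular_mulVec {k : Type} [Fintype k] [DecidableEq k]
    (B : Matrix k k ℚ) (hB : ∀ i j, B i j ∈ ratIntegers)
    (hdet : B.det = 1 ∨ B.det = -1) (x : k → ℚ)
    (hx : ∀ i, (B *ᵥ x) i ∈ ratIntegers) (i : k) : x i ∈ ratIntegers := by
  choose C hC using hB
  have hBC : B = (Int.castRingHom ℚ).mapMatrix (of C) := by
    ext i j; simp [← hC]
  have hadj : ∀ i j, B.adjugate i j ∈ ratIntegers := fun i j => by
    rw [hBC, ← RingHom.map_adjugate]
    exact ⟨_, rfl⟩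
  have hdx : B.det * x i = ∑ j, B.adjugate i j * (B *ᵥ x) j := by
    have := congrFun (congrArg (· *ᵥ x) (adjugate_mul B)) i
    simp only [← mulVec_mulVec, smul_mulVec, one_mulVec, Pi.smul_apply, smul_eq_mul] at this
    rw [← this]; rfl
  have hmem : B.det * x i ∈ ratIntegers := by
    rw [hdx]
    exact sum_mem fun j _ => mul_mem (hadj i j) (hx j)
  rcases hdet with h | h <;> rw [h] at hmem
  · simpa using hmem
  · simpa using neg_mem hmem

theorem Matrix.IsTotallyUnimodular.mem_ratIntegers {k l : Type} {A : Matrix k l ℚ}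
    (hA : A.IsTotallyUnimodular) (i : k) (j : l) : A i j ∈ ratIntegers := by
  obtain ⟨s, hs⟩ := hA.apply i j
  rw [← hs]
  cases s <;> simp

/-- A totally unimodular matrix with trivial kernel reflects integrality. -/
theorem Matrix.IsTotallyUnimodular.integral_of_injective {k l : Type} [Fintype k] [Fintype l]
    [DecidableEq l] {A : Matrix k l ℚ} (hA : A.IsTotallyUnimodular)
    (hker : ∀ d, A *ᵥ d = 0 → d = 0) (x : l → ℚ)
    (hx : ∀ i, (A *ᵥ x) i ∈ ratIntegers) (j : l) : x j ∈ ratIntegers := by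
  have hinj : Function.Injective A.mulVec := by
    intro a b hab
    have := hker (a - b) (by rw [mulVec_sub]; exact sub_eq_zero.2 hab)
    exact sub_eq_zero.1 this
  have hrank : A.rank = Fintype.card l := by
    rw [Matrix.rank, LinearMap.finrank_range_of_inj (f := A.mulVecLin) hinj,
      Module.finrank_fintype_fun_eq_card]
  have hspan : Submodule.span ℚ (Set.range A.row) = ⊤ := by
    apply Submodule.eq_top_of_finrank_eq
    rw [← Matrix.rank_eq_finrank_span_row, hrank, Module.finrank_fintype_fun_eq_card]
  obtain ⟨r, a, ha, hspan', hli⟩ := exists_linearIndependent' ℚ A.row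
  let b : Module.Basis r ℚ (l → ℚ) := Module.Basis.mk hli (by rw [hspan', hspan])
  have e : l ≃ r := (Pi.basisFun ℚ l).indexEquiv b
  let B : Matrix l l ℚ := A.submatrix (a ∘ e) id
  have hBli : LinearIndependent ℚ B.row := hli.comp e e.injective
  have hdet : B.det ≠ 0 := by
    have := (Matrix.linearIndependent_rows_iff_isUnit.1 hBli)
    exact ((Matrix.isUnit_iff_isUnit_det B).1 this).ne_zero
  refine integral_of_unimodular_mulVec B (fun i j => hA.mem_ratIntegers _ _) ?_ x
    (fun i => hx (a (e i))) j
  obtain ⟨s, hs⟩ := (isTotallyUnimodular_iff_fintype A).1 hA l (a ∘ e) id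
  change _ = B.det at hs
  rw [← hs] at hdet ⊢
  cases s <;> simp at hdet ⊢

/-- Every integer bound satisfied by `r` is satisfied by `r'`. -/
def RespectsIntBounds {k : Type} (r r' : k → ℚ) : Prop :=
  ∀ i, ∀ z : ℤ, ((z : ℚ) ≤ r i → (z : ℚ) ≤ r' i) ∧ (r i ≤ z → r' i ≤ z)

theorem RespectsIntBounds.trans {k : Type} {r s t : k → ℚ} (h : RespectsIntBounds r s)
    (h' : RespectsIntBounds s t) : RespectsIntBounds r t :=
  fun i z => ⟨fun hz => (h' i z).1 ((h i z).1 hz), fun hz => (h' i z).2 ((h i z).2 hz)⟩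

/-- Moving along `a` until the first noninteger coordinate of `r` becomes an integer. -/
theorem exists_step_respectsIntBounds {k : Type} [Fintype k] (r a : k → ℚ) (ha : a ≠ 0)
    (hra : ∀ i, r i ∈ ratIntegers → a i = 0) :
    ∃ t : ℚ, 0 ≤ t ∧ RespectsIntBounds r (fun i => r i + t * a i) ∧
      ∃ i, r i ∉ ratIntegers ∧ r i + t * a i ∈ ratIntegers := by
  classical
  let τ : k → ℚ := fun i => if 0 < a i then (⌈r i⌉ - r i) / a i else (⌊r i⌋ - r i) / a i
  obtain ⟨i₀, hi₀⟩ := Function.ne_iff.1 ha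
  obtain ⟨i, hi, hmin⟩ := Finset.exists_min_image (Finset.univ.filter fun i => a i ≠ 0) τ
    ⟨i₀, by simpa using hi₀⟩
  have hai : a i ≠ 0 := by simpa using hi
  have hτ : ∀ j, 0 ≤ τ j := fun j => by
    dsimp only [τ]
    split_ifs with h
    · exact div_nonneg (sub_nonneg.2 (Int.le_ceil _)) h.le
    · exact div_nonneg_of_nonpos (sub_nonpos.2 (Int.floor_le _)) (not_lt.1 h)
  refine ⟨τ i, hτ i, fun j z => ?_, i, fun h => hai (hra i h), ?_⟩
  · dsimp only
    have h0 := hτ i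
    rcases lt_trichotomy (a j) 0 with h | h | h
    · have h1 : τ i ≤ (⌊r j⌋ - r j) / a j := by
        have := hmin j (by simpa using h.ne)
        simpa only [τ, not_lt.2 h.le, if_false] using this
      rw [le_div_iff_of_neg h] at h1
      refine ⟨fun hz => ?_, fun hz => ?_⟩
      · have : (z : ℚ) ≤ ⌊r j⌋ := by exact_mod_cast Int.le_floor.2 hz
        linarith
      · nlinarith
    · simp [h]
    · have h1 : τ i ≤ (⌈r j⌉ - r j) / a j := by
        have := hmin j (by simpa using h.ne')
        simpa only [τ, h, if_true] using this
      rw [le_div_iff₀ h] at h1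
      refine ⟨fun hz => ?_, fun hz => ?_⟩
      · nlinarith
      · have : (⌈r j⌉ : ℚ) ≤ z := by exact_mod_cast Int.ceil_le.2 hz
        linarith
  · rw [mem_ratIntegers]
    dsimp only [τ]
    split_ifs
    · exact ⟨⌈r i⌉, by field_simp; ring⟩
    · exact ⟨⌊r i⌋, by field_simp; ring⟩

/-- Rounding a rational point to an integral one for a totally unimodular system of
constraints, without decreasing a given linear objective. -/
theorem Matrix.IsTotallyUnimodular.exists_rounding {k l : Type} [Fintype k] [Fintype l]
    [DecidableEq l] {A : Matrix k l ℚ} (hA : A.IsTotallyUnimodular)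
    (hker : ∀ d, A *ᵥ d = 0 → d = 0) (w : l → ℚ) (x : l → ℚ) :
    ∃ x' : l → ℚ, (∀ j, x' j ∈ ratIntegers) ∧ RespectsIntBounds (A *ᵥ x) (A *ᵥ x') ∧
      w ⬝ᵥ x ≤ w ⬝ᵥ x' := by
  classical
  induction h : (Finset.univ.filter fun i => (A *ᵥ x) i ∉ ratIntegers).card
    using Nat.strong_induction_on generalizing x with
  | _ N ih =>
  by_cases hd : ∃ d : l → ℚ, d ≠ 0 ∧ ∀ i, (A *ᵥ x) i ∈ ratIntegers → (A *ᵥ d) i = 0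
  · obtain ⟨d, hd0, hdI, hwd⟩ : ∃ d : l → ℚ, d ≠ 0 ∧
        (∀ i, (A *ᵥ x) i ∈ ratIntegers → (A *ᵥ d) i = 0) ∧ 0 ≤ w ⬝ᵥ d := by
      obtain ⟨d, hd0, hdI⟩ := hd
      rcases le_total 0 (w ⬝ᵥ d) with hw | hw
      · exact ⟨d, hd0, hdI, hw⟩
      · exact ⟨-d, neg_ne_zero.2 hd0, fun i hi => by simp [mulVec_neg, hdI i hi], by simpa using hw⟩
    obtain ⟨t, ht, hresp, i₀, hi₀, hi₀'⟩ := exists_step_respectsIntBounds (A *ᵥ x) (A *ᵥ d)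
      (fun h0 => hd0 (hker d h0)) hdI
    have hmv : A *ᵥ (x + t • d) = fun i => (A *ᵥ x) i + t * (A *ᵥ d) i := by
      ext i; simp [mulVec_add, mulVec_smul]
    have hlt : (Finset.univ.filter fun i => (A *ᵥ (x + t • d)) i ∉ ratIntegers).card < N := by
      rw [← h]
      refine Finset.card_lt_card (Finset.ssubset_iff_of_subset ?_ |>.2 ⟨i₀, ?_, ?_⟩)
      · intro i hi
        simp only [Finset.mem_filter, Finset.mem_univ, true_and] at hi ⊢
        intro hmem
        apply hi
        rw [hmv]
        simpa only [hdI i hmem, mul_zero, add_zero] using hmem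
      · simpa only [Finset.mem_filter, Finset.mem_univ, true_and] using hi₀
      · simp only [Finset.mem_filter, Finset.mem_univ, true_and, not_not]
        rw [hmv]
        exact hi₀'
    obtain ⟨x', hx', hr, hw⟩ := ih _ hlt (x + t • d) rfl
    refine ⟨x', hx', RespectsIntBounds.trans (hmv ▸ hresp) hr, le_trans ?_ hw⟩
    rw [dotProduct_add, dotProduct_smul, smul_eq_mul]
    linarith [mul_nonneg ht hwd]
  · push Not at hd
    refine ⟨x, fun j => ?_, fun i z => ⟨id, id⟩, le_rfl⟩
    refine (hA.submatrix (Subtype.val : {i // (A *ᵥ x) i ∈ ratIntegers} → k)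
      id).integral_of_injective (fun d hd' => ?_) x (fun i => i.2) j
    by_contra hne
    obtain ⟨i, hi, hi'⟩ := hd d hne
    exact hi' (congrFun hd' ⟨i, hi⟩)

/-- The support function of the box `lo ≤ x ≤ hi`. -/
def boxSupport {k : Type} [Fintype k] (lo hi r : k → ℚ) : ℚ :=
  ∑ j, if 0 ≤ r j then r j * hi j else r j * lo j

/-- The domain of the support function of the box whose finite lower and upper bounds are at
the coordinates satisfying `L` and `U`. -/
def BoxSupportDom {k : Type} (L U : k → Prop) (r : k → ℚ) : Prop :=
  ∀ j, (0 < r j → U j) ∧ (r j < 0 → L j)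

section BoxSupport

variable {k : Type} {L U : k → Prop} {lo hi r s : k → ℚ}

theorem boxSupportDom_zero : BoxSupportDom L U 0 := fun j => by simp

theorem BoxSupportDom.add (hr : BoxSupportDom L U r) (hs : BoxSupportDom L U s) :
    BoxSupportDom L U (r + s) := fun j => by
  refine ⟨fun h => ?_, fun h => ?_⟩
  · by_cases h0 : 0 < r j
    · exact (hr j).1 h0
    · exact (hs j).1 (by simp only [Pi.add_apply] at h; linarith)
  · by_cases h0 : r j < 0
    · exact (hr j).2 h0
    · exact (hs j).2 (by simp only [Pi.add_apply] at h; linarith)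

theorem BoxSupportDom.smul {c : ℚ} (hc : 0 ≤ c) (hr : BoxSupportDom L U r) :
    BoxSupportDom L U (c • r) := fun j => by
  simp only [Pi.smul_apply, smul_eq_mul]
  exact ⟨fun h => (hr j).1 (pos_of_mul_pos_right h hc),
    fun h => (hr j).2 (neg_of_mul_neg_right h hc)⟩

theorem BoxSupportDom.of_sign (hr : BoxSupportDom L U r)
    (h : ∀ j, (0 ≤ r j → 0 ≤ s j) ∧ (r j ≤ 0 → s j ≤ 0)) : BoxSupportDom L U s := fun j =>
  ⟨fun hs => (hr j).1 (not_le.1 fun h' => (((h j).2 h').trans_lt hs).false),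
    fun hs => (hr j).2 (not_le.1 fun h' => (((h j).1 h').trans_lt hs).false)⟩

variable [Fintype k]

@[simp] theorem boxSupport_zero : boxSupport lo hi 0 = 0 := by simp [boxSupport]

theorem boxSupport_smul {c : ℚ} (hc : 0 ≤ c) :
    boxSupport lo hi (c • r) = c * boxSupport lo hi r := by
  rcases hc.eq_or_lt with rfl | hc
  · simp
  · simp only [boxSupport, Finset.mul_sum, Pi.smul_apply, smul_eq_mul]
    refine Finset.sum_congr rfl fun j _ => ?_
    simp only [mul_nonneg_iff_of_pos_left hc]
    split_ifs <;> ring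

theorem boxSupport_add_le (hlu : ∀ j, L j → U j → lo j ≤ hi j) (hr : BoxSupportDom L U r)
    (hs : BoxSupportDom L U s) :
    boxSupport lo hi (r + s) ≤ boxSupport lo hi r + boxSupport lo hi s := by
  simp only [boxSupport, ← Finset.sum_add_distrib, Pi.add_apply]
  refine Finset.sum_le_sum fun j _ => ?_
  have key : ∀ a b : ℚ, (0 < a → U j) → (b < 0 → L j) → 0 ≤ a → b < 0 →
      a * hi j + b * lo j ≥ (if 0 ≤ a + b then (a + b) * hi j else (a + b) * lo j) := by
    intro a b ha hb ha0 hb0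
    rcases ha0.eq_or_lt with rfl | ha0
    · simp [hb0.not_ge]
    · have := hlu j (hb hb0) (ha ha0)
      split_ifs <;> nlinarith
  by_cases h1 : 0 ≤ r j <;> by_cases h2 : 0 ≤ s j
  · simp only [h1, h2, add_nonneg, if_true]
    linarith
  · simpa only [h1, h2, if_true, if_false] using
      key _ _ (hr j).1 (hs j).2 h1 (not_le.1 h2)
  · simpa only [h1, h2, if_true, if_false, add_comm] using
      key _ _ (hs j).1 (hr j).2 h2 (not_le.1 h1)
  · have : ¬ 0 ≤ r j + s j := by linarith
    simp only [h1, h2, this, if_false]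
    linarith

theorem boxSupport_sum_le (hlu : ∀ j, L j → U j → lo j ≤ hi j) {ι : Type} (t : Finset ι)
    {y : ι → ℚ} (hy : ∀ i ∈ t, 0 ≤ y i) {v : ι → k → ℚ} (hv : ∀ i ∈ t, BoxSupportDom L U (v i)) :
    BoxSupportDom L U (∑ i ∈ t, y i • v i) ∧
      boxSupport lo hi (∑ i ∈ t, y i • v i) ≤ ∑ i ∈ t, y i * boxSupport lo hi (v i) := by
  classical
  induction t using Finset.induction_on with
  | empty => simpa using boxSupportDom_zero
  | insert a t ha ih =>
    obtain ⟨h1, h2⟩ := ih (fun i hi => hy i (Finset.mem_insert_of_mem hi))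
      (fun i hi => hv i (Finset.mem_insert_of_mem hi))
    have ha0 := hy a (Finset.mem_insert_self a t)
    have ha1 := (hv a (Finset.mem_insert_self a t)).smul ha0
    rw [Finset.sum_insert ha, Finset.sum_insert ha]
    refine ⟨ha1.add h1, (boxSupport_add_le hlu ha1 h1).trans ?_⟩
    rw [boxSupport_smul ha0]
    linarith

theorem boxSupport_eq_of_sign (h : ∀ j, (0 ≤ r j → 0 ≤ s j) ∧ (r j ≤ 0 → s j ≤ 0)) :
    boxSupport lo hi s = s ⬝ᵥ fun j => if 0 ≤ r j then hi j else lo j := by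
  refine Finset.sum_congr rfl fun j _ => ?_
  dsimp only
  by_cases h1 : 0 ≤ r j
  · simp [h1, (h j).1 h1]
  · have h2 := (h j).2 (not_le.1 h1).le
    rcases h2.eq_or_lt with h3 | h3
    · simp [h3]
    · simp [h1, not_le.2 h3]

theorem boxSupport_eq_self :
    boxSupport lo hi r = r ⬝ᵥ fun j => if 0 ≤ r j then hi j else lo j :=
  boxSupport_eq_of_sign fun _ => ⟨id, id⟩

theorem dotProduct_le_boxSupport (hr : BoxSupportDom L U r) {x : k → ℚ}
    (hx : ∀ j, (L j → lo j ≤ x j) ∧ (U j → x j ≤ hi j)) :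
    r ⬝ᵥ x ≤ boxSupport lo hi r := by
  refine Finset.sum_le_sum fun j _ => ?_
  rcases lt_trichotomy (r j) 0 with h | h | h
  · rw [if_neg h.not_ge]
    nlinarith [(hx j).1 ((hr j).2 h)]
  · simp [h]
  · rw [if_pos h.le]
    nlinarith [(hx j).2 ((hr j).1 h)]

theorem boxSupport_mem_ratIntegers (hlo : ∀ j, lo j ∈ ratIntegers) (hhi : ∀ j, hi j ∈ ratIntegers)
    (hr : ∀ j, r j ∈ ratIntegers) : boxSupport lo hi r ∈ ratIntegers :=
  sum_mem fun j _ => by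
    split_ifs
    exacts [mul_mem (hr j) (hhi j), mul_mem (hr j) (hlo j)]

end BoxSupport

/-- A form of Farkas' lemma: if the convex cone `K` of valid inequalities `b ≤ a ⬝ᵥ x` contains
no contradiction `0 < b ≤ 0`, then any finite subset of `K` is satisfiable. -/
theorem exists_forall_le_dotProduct {l : Type} [Fintype l]
    {K : Set ((l → ℚ) × ℚ)} (hadd : ∀ p ∈ K, ∀ q ∈ K, p + q ∈ K)
    (hsmul : ∀ c : ℚ, 0 < c → ∀ p ∈ K, c • p ∈ K) (hK : ∀ b, ((0 : l → ℚ), b) ∈ K → b ≤ 0)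
    {S : Set ((l → ℚ) × ℚ)} (hS : S.Finite) (hSK : S ⊆ K) :
    ∃ x : l → ℚ, ∀ p ∈ S, p.2 ≤ p.1 ⬝ᵥ x := by
  classical
  suffices H : ∀ (J : Finset l) (S : Set ((l → ℚ) × ℚ)), S.Finite → S ⊆ K →
      (∀ p ∈ S, ∀ j ∉ J, p.1 j = 0) → ∃ x : l → ℚ, ∀ p ∈ S, p.2 ≤ p.1 ⬝ᵥ x from
    H Finset.univ S hS hSK fun p _ j hj => absurd (Finset.mem_univ j) hj
  intro J
  induction J using Finset.induction_on with
  | empty =>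
    intro S _ hSK hS0
    refine ⟨0, fun p hp => ?_⟩
    have h0 : p.1 = 0 := funext fun j => hS0 p hp j (Finset.notMem_empty j)
    have := hK p.2 (by rw [← h0]; exact hSK hp)
    simpa using this
  | insert a J ha ih =>
    intro S hS hSK hS0
    let f : (l → ℚ) × ℚ → (l → ℚ) × ℚ → (l → ℚ) × ℚ := fun p q => p.1 a • q + (-q.1 a) • p
    obtain ⟨x, hx⟩ := ih ({p ∈ S | p.1 a = 0} ∪
        Set.image2 f {p ∈ S | 0 < p.1 a} {p ∈ S | p.1 a < 0})
      ((hS.subset (Set.sep_subset _ _)).union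
        (.image2 _ (hS.subset (Set.sep_subset _ _)) (hS.subset (Set.sep_subset _ _))))
      (by
        rintro _ (⟨hp, -⟩ | ⟨p, ⟨hp, hpa⟩, q, ⟨hq, hqa⟩, rfl⟩)
        · exact hSK hp
        · exact hadd _ (hsmul _ hpa _ (hSK hq)) _ (hsmul _ (neg_pos.2 hqa) _ (hSK hp)))
      (by
        rintro _ (⟨hp, hpa⟩ | ⟨p, ⟨hp, hpa⟩, q, ⟨hq, hqa⟩, rfl⟩) j hj
        · by_cases hja : j = a
          · rw [hja, hpa]
          · exact hS0 _ hp j (by simp [hja, hj])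
        · by_cases hja : j = a
          · subst hja; simp [f]; ring
          · have h1 := hS0 _ hp j (by simp [hja, hj])
            have h2 := hS0 _ hq j (by simp [hja, hj])
            simp [f, h1, h2])
    have hdot : ∀ (p : (l → ℚ) × ℚ) (t : ℚ),
        p.1 ⬝ᵥ (x + t • Pi.single a 1) = p.1 ⬝ᵥ x + t * p.1 a := by
      intro p t
      simp [dotProduct_add, dotProduct_smul]
    suffices ∃ t : ℚ, (∀ p ∈ S, 0 < p.1 a → (p.2 - p.1 ⬝ᵥ x) / p.1 a ≤ t) ∧
        ∀ q ∈ S, q.1 a < 0 → t ≤ (q.2 - q.1 ⬝ᵥ x) / q.1 a by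
      obtain ⟨t, ht1, ht2⟩ := this
      refine ⟨x + t • Pi.single a 1, fun p hp => ?_⟩
      rw [hdot]
      rcases lt_trichotomy (p.1 a) 0 with h | h | h
      · have := ht2 p hp h
        rw [le_div_iff_of_neg h] at this
        linarith
      · have := hx p (Or.inl ⟨hp, h⟩)
        simpa [h] using this
      · have := ht1 p hp h
        rw [div_le_iff₀ h] at this
        linarith
    have hpq : ∀ p ∈ S, 0 < p.1 a → ∀ q ∈ S, q.1 a < 0 →
        (p.2 - p.1 ⬝ᵥ x) / p.1 a ≤ (q.2 - q.1 ⬝ᵥ x) / q.1 a := by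
      intro p hp hpa q hq hqa
      have := hx (f p q) (Or.inr ⟨p, ⟨hp, hpa⟩, q, ⟨hq, hqa⟩, rfl⟩)
      simp only [f, Prod.fst_add, Prod.snd_add, Prod.smul_fst, Prod.smul_snd, add_dotProduct,
        smul_dotProduct, smul_eq_mul] at this
      rw [div_le_iff₀ hpa, div_mul_eq_mul_div, le_div_iff_of_neg hqa]
      linarith
    have hfinP : {p ∈ S | 0 < p.1 a}.Finite := hS.subset (Set.sep_subset _ _)
    have hfinN : {p ∈ S | p.1 a < 0}.Finite := hS.subset (Set.sep_subset _ _)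
    by_cases hne : {p ∈ S | 0 < p.1 a}.Nonempty
    · obtain ⟨p, ⟨hp, hpa⟩, hmax⟩ :=
        Set.exists_max_image _ (fun p : (l → ℚ) × ℚ => (p.2 - p.1 ⬝ᵥ x) / p.1 a) hfinP hne
      exact ⟨_, fun q hq hqa => hmax q ⟨hq, hqa⟩, fun q hq hqa => hpq p hp hpa q hq hqa⟩
    · have hP : ∀ p ∈ S, ¬ 0 < p.1 a := fun p hp h => hne ⟨p, hp, h⟩
      by_cases hne' : {p ∈ S | p.1 a < 0}.Nonempty
      · obtain ⟨q, ⟨hq, hqa⟩, hmin⟩ :=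
          Set.exists_min_image _ (fun p : (l → ℚ) × ℚ => (p.2 - p.1 ⬝ᵥ x) / p.1 a) hfinN hne'
        exact ⟨_, fun p hp hpa => absurd hpa (hP p hp), fun q' hq' hqa' => hmin q' ⟨hq', hqa'⟩⟩
      · exact ⟨0, fun p hp hpa => absurd hpa (hP p hp), fun q hq hqa => absurd ⟨q, hq, hqa⟩ hne'⟩

theorem exists_nat_mul_mem_ratIntegers {ι : Type} [Fintype ι] (x : ι → ℚ) :
    ∃ D : ℕ, 0 < D ∧ ∀ i, (D : ℚ) * x i ∈ ratIntegers := by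
  refine ⟨∏ i, (x i).den, Finset.prod_pos fun i _ => (x i).den_pos, fun i => ?_⟩
  obtain ⟨e, he⟩ := Finset.dvd_prod_of_mem (fun i => (x i).den) (Finset.mem_univ i)
  rw [he, mem_ratIntegers]
  refine ⟨e * (x i).num, ?_⟩
  have := Rat.den_mul_eq_num (x i)
  push_cast
  rw [← this]
  ring

theorem exists_nat_forall_abs_le {ι : Type} [Finite ι] (x : ι → ℚ) :
    ∃ N : ℕ, ∀ i, |x i| ≤ N := by
  obtain ⟨b, hb⟩ := (Set.finite_range fun i => |x i|).bddAbove
  obtain ⟨N, hN⟩ := exists_nat_ge b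
  exact ⟨N, fun i => (hb ⟨i, rfl⟩).trans hN⟩

/-- Rounding `r / (N + 1)` splits off from an integral `r` a sign-compatible vector with entries
in `{-1, 0, 1}`, and the remainder is bounded by `N`. -/
theorem RespectsIntBounds.peel {k : Type} {N : ℕ} {r s : k → ℚ}
    (h : RespectsIntBounds ((N + 1 : ℚ)⁻¹ • r) s) {j : k} (hr : r j ∈ ratIntegers)
    (hs : s j ∈ ratIntegers) (hN : |r j| ≤ (N + 1 : ℕ)) :
    |s j| ≤ 1 ∧ |r j - s j| ≤ N ∧ (0 ≤ r j → 0 ≤ s j ∧ 0 ≤ r j - s j) ∧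
      (r j ≤ 0 → s j ≤ 0 ∧ r j - s j ≤ 0) := by
  obtain ⟨z, hz⟩ := mem_ratIntegers.1 hr
  obtain ⟨w, hw⟩ := mem_ratIntegers.1 hs
  have hpos : (0 : ℚ) < N + 1 := by positivity
  have h1 : ∀ t : ℤ, t * (N + 1) ≤ z → t ≤ w := fun t ht => by
    have := (h j t).1 (by
      rw [Pi.smul_apply, smul_eq_mul, hz, inv_mul_eq_div, le_div_iff₀ hpos]
      exact_mod_cast ht)
    rw [hw] at this
    exact_mod_cast this
  have h2 : ∀ t : ℤ, z ≤ t * (N + 1) → w ≤ t := fun t ht => by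
    have := (h j t).2 (by
      rw [Pi.smul_apply, smul_eq_mul, hz, inv_mul_eq_div, div_le_iff₀ hpos]
      exact_mod_cast ht)
    rw [hw] at this
    exact_mod_cast this
  have hN' : |z| ≤ (N + 1 : ℤ) := by
    rw [hz] at hN
    exact_mod_cast hN
  rw [abs_le] at hN'
  have a1 := h1 0
  have a2 := h2 0
  have b1 := h1 1
  have b2 := h2 1
  have c1 := h1 (-1)
  have c2 := h2 (-1)
  rw [hz, hw]
  norm_cast
  simp only [abs_le]
  refine ⟨⟨?_, ?_⟩, ⟨?_, ?_⟩, fun _ => ⟨?_, ?_⟩, fun _ => ⟨?_, ?_⟩⟩ <;> omega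

theorem vecMul_mem_ratIntegers {k l : Type} [Fintype l] {Q : Matrix l k ℚ}
    (hQ : Q.IsTotallyUnimodular) {x : l → ℚ}
    (hx : ∀ i, x i ∈ ratIntegers) (j : k) : (x ᵥ* Q) j ∈ ratIntegers :=
  sum_mem fun i _ => mul_mem (hx i) (hQ.mem_ratIntegers i j)

section VecMul

variable {k l : Type} [Fintype k] [Fintype l] {Q : Matrix l k ℚ}

theorem Matrix.IsTotallyUnimodular.exists_rounding_vecMul (hQ : Q.IsTotallyUnimodular)
    (w x : l → ℚ) :
    ∃ x' : l → ℚ, (∀ i, x' i ∈ ratIntegers) ∧ RespectsIntBounds x x' ∧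
      RespectsIntBounds (x ᵥ* Q) (x' ᵥ* Q) ∧ w ⬝ᵥ x ≤ w ⬝ᵥ x' := by
  classical
  have hA := (fromRows_one_isTotallyUnimodular_iff Qᵀ).2 hQ.transpose
  have hl : ∀ y j, (fromRows Qᵀ (1 : Matrix l l ℚ) *ᵥ y) (Sum.inl j) = (y ᵥ* Q) j := by
    simp [fromRows_mulVec, mulVec_transpose]
  have hr : ∀ y i, (fromRows Qᵀ (1 : Matrix l l ℚ) *ᵥ y) (Sum.inr i) = y i := by
    simp [fromRows_mulVec]
  obtain ⟨x', hx', hresp, hw⟩ := hA.exists_rounding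
    (fun d hd => funext fun i => by rw [← hr d i, hd]; rfl) w x
  exact ⟨x', hx', fun i => by simpa only [hr] using hresp (Sum.inr i),
    fun j => by simpa only [hl] using hresp (Sum.inl j), hw⟩

variable {L U : k → Prop} {lo hi : k → ℚ} {ι : Type} [Fintype ι] {v : ι → l → ℚ}

/-- Integral decomposition: an integral `x` is a sign-compatible sum of vectors with entries in
`{-1, 0, 1}`. -/
theorem exists_integral_decomposition (hQ : Q.IsTotallyUnimodular)
    (hv : ∀ ρ : l → ℚ, (∀ i, ρ i ∈ ratIntegers) → (∀ i, |ρ i| ≤ 1) →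
      BoxSupportDom L U (ρ ᵥ* Q) → ∃ a, v a = ρ)
    {x : l → ℚ} (hx : ∀ i, x i ∈ ratIntegers) (hdom : BoxSupportDom L U (x ᵥ* Q)) :
    ∃ y : ι → ℚ, (∀ a, y a ∈ ratIntegers) ∧ 0 ≤ y ∧ ∑ a, y a • v a = x ∧
      ∑ a, y a * boxSupport lo hi (v a ᵥ* Q) = boxSupport lo hi (x ᵥ* Q) := by
  classical
  obtain ⟨N₁, hN₁⟩ := exists_nat_forall_abs_le x
  obtain ⟨N₂, hN₂⟩ := exists_nat_forall_abs_le (x ᵥ* Q)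
  obtain ⟨N, hx1, hx2⟩ : ∃ N : ℕ, (∀ i, |x i| ≤ N) ∧ ∀ j, |(x ᵥ* Q) j| ≤ N :=
    ⟨N₁ + N₂, fun i => (hN₁ i).trans (by simp), fun j => (hN₂ j).trans (by simp)⟩
  clear hN₁ hN₂ N₁ N₂
  induction N generalizing x with
  | zero =>
    have : x = 0 := funext fun i => by simpa using hx1 i
    subst this
    exact ⟨0, fun _ => zero_mem _, le_rfl, by simp, by simp⟩
  | succ N ih =>
    obtain ⟨ρ, hρ, hρ1, hρ2, -⟩ := hQ.exists_rounding_vecMul 0 ((N + 1 : ℚ)⁻¹ • x)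
    rw [smul_vecMul] at hρ2
    have hxQ := vecMul_mem_ratIntegers hQ hx
    have hρQ := vecMul_mem_ratIntegers hQ hρ
    have h1 := fun i => hρ1.peel (hx i) (hρ i) (hx1 i)
    have h2 := fun j => hρ2.peel (hxQ j) (hρQ j) (hx2 j)
    have hsub : (x - ρ) ᵥ* Q = x ᵥ* Q - ρ ᵥ* Q := sub_vecMul _ _ _
    have sρ : ∀ j, (0 ≤ (x ᵥ* Q) j → 0 ≤ (ρ ᵥ* Q) j) ∧ ((x ᵥ* Q) j ≤ 0 → (ρ ᵥ* Q) j ≤ 0) :=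
      fun j => ⟨fun h => ((h2 j).2.2.1 h).1, fun h => ((h2 j).2.2.2 h).1⟩
    have sd : ∀ j, (0 ≤ (x ᵥ* Q) j → 0 ≤ ((x - ρ) ᵥ* Q) j) ∧
        ((x ᵥ* Q) j ≤ 0 → ((x - ρ) ᵥ* Q) j ≤ 0) := fun j => by
      rw [hsub]
      exact ⟨fun h => ((h2 j).2.2.1 h).2, fun h => ((h2 j).2.2.2 h).2⟩
    obtain ⟨a, ha⟩ := hv ρ hρ (fun i => (h1 i).1) (hdom.of_sign sρ)
    obtain ⟨y, hy1, hy2, hy3, hy4⟩ := ih (x := x - ρ) (fun i => sub_mem (hx i) (hρ i))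
      (hdom.of_sign sd) (fun i => (h1 i).2.1) (fun j => by rw [hsub]; exact (h2 j).2.1)
    refine ⟨y + Pi.single a 1, fun b => add_mem (hy1 b) ?_, add_nonneg hy2 ?_, ?_, ?_⟩
    · by_cases hb : b = a
      · subst hb; simp
      · simp [hb]
    · exact Pi.single_nonneg.2 zero_le_one
    · simp [add_smul, Finset.sum_add_distrib, hy3, Pi.single_apply, ite_smul, ha]
    · simp only [Pi.add_apply, add_mul, Finset.sum_add_distrib, hy4, Pi.single_apply, ite_mul,
        zero_mul, one_mul, Finset.sum_ite_eq', Finset.mem_univ, if_true, ha]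
      rw [boxSupport_eq_of_sign sd, boxSupport_eq_of_sign sρ, boxSupport_eq_self (r := x ᵥ* Q),
        ← add_dotProduct, hsub, sub_add_cancel]

theorem boxSupport_single [DecidableEq k] (j : k) (c : ℚ) :
    boxSupport lo hi (Pi.single j c) = if 0 ≤ c then c * hi j else c * lo j := by
  rw [boxSupport, Finset.sum_eq_single j]
  · simp
  · intro b _ hb
    simp [hb]
  · simp

/-- The image of a box under a totally unimodular matrix is described by the inequalities with
coefficients in `{-1, 0, 1}`. -/
theorem mem_boxImage_iff (hQ : Q.IsTotallyUnimodular) (hlu : ∀ j, L j → U j → lo j ≤ hi j)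
    (hdom : ∀ a, BoxSupportDom L U (v a ᵥ* Q))
    (hv : ∀ ρ : l → ℚ, (∀ i, ρ i ∈ ratIntegers) → (∀ i, |ρ i| ≤ 1) →
      BoxSupportDom L U (ρ ᵥ* Q) → ∃ a, v a = ρ) (z : l → ℚ) :
    (∃ x : k → ℚ, (∀ j, (L j → lo j ≤ x j) ∧ (U j → x j ≤ hi j)) ∧ z = Q *ᵥ x) ↔
      ∀ a, v a ⬝ᵥ z ≤ boxSupport lo hi (v a ᵥ* Q) := by
  classical
  constructor
  · rintro ⟨x, hx, rfl⟩ a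
    rw [dotProduct_mulVec]
    exact dotProduct_le_boxSupport (hdom a) hx
  intro hz
  have hvalid : ∀ π : l → ℚ, BoxSupportDom L U (π ᵥ* Q) →
      π ⬝ᵥ z ≤ boxSupport lo hi (π ᵥ* Q) := by
    intro π hπ
    obtain ⟨D, hD, hDπ⟩ := exists_nat_mul_mem_ratIntegers π
    have hD' : (0 : ℚ) < D := by exact_mod_cast hD
    obtain ⟨y, -, hy, hyv, hyH⟩ := exists_integral_decomposition (lo := lo) (hi := hi) hQ hv
      (x := (D : ℚ) • π) hDπ (by rw [smul_vecMul]; exact hπ.smul hD'.le)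
    rw [smul_vecMul, boxSupport_smul hD'.le] at hyH
    refine le_of_mul_le_mul_left ?_ hD'
    rw [← hyH, ← smul_eq_mul, ← smul_dotProduct, ← hyv, sum_dotProduct]
    refine Finset.sum_le_sum fun a _ => ?_
    rw [smul_dotProduct, smul_eq_mul]
    exact mul_le_mul_of_nonneg_left (hz a) (hy a)
  let K : Set ((k → ℚ) × ℚ) := {p | ∃ (π : l → ℚ) (r : k → ℚ), BoxSupportDom L U r ∧
    p.1 = π ᵥ* Q - r ∧ p.2 ≤ π ⬝ᵥ z - boxSupport lo hi r}
  let S : Set ((k → ℚ) × ℚ) :=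
    (Set.range (fun i => (Q i, z i)) ∪ Set.range (fun i => (-Q i, -z i))) ∪
    ((fun j => (Pi.single j 1, lo j)) '' {j | L j} ∪
      (fun j => (Pi.single j (-1), -hi j)) '' {j | U j})
  have hS : S.Finite := ((Set.finite_range _).union (Set.finite_range _)).union
    (((Set.toFinite _).image _).union ((Set.toFinite _).image _))
  have hex : ∃ x : k → ℚ, ∀ p ∈ S, p.2 ≤ p.1 ⬝ᵥ x := by
    refine exists_forall_le_dotProduct (K := K) ?_ ?_ ?_ hS ?_
    · rintro p ⟨π, r, hr, hp, hp'⟩ q ⟨π', r', hr', hq, hq'⟩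
      refine ⟨π + π', r + r', hr.add hr', ?_, ?_⟩
      · rw [Prod.fst_add, hp, hq, add_vecMul]; abel
      · rw [Prod.snd_add, add_dotProduct]
        linarith [boxSupport_add_le hlu hr hr']
    · rintro c hc p ⟨π, r, hr, hp, hp'⟩
      refine ⟨c • π, c • r, hr.smul hc.le, ?_, ?_⟩
      · rw [Prod.smul_fst, hp, smul_vecMul, smul_sub]
      · rw [Prod.smul_snd, smul_dotProduct, boxSupport_smul hc.le, smul_eq_mul, smul_eq_mul,
          ← mul_sub]
        exact mul_le_mul_of_nonneg_left hp' hc.le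
    · rintro b ⟨π, r, hr, hp, hp'⟩
      have hr' : r = π ᵥ* Q := (sub_eq_zero.1 hp.symm).symm
      subst hr'
      linarith [hvalid π hr]
    · rintro _ ((⟨i, rfl⟩ | ⟨i, rfl⟩) | (⟨j, hj, rfl⟩ | ⟨j, hj, rfl⟩))
      · exact ⟨Pi.single i 1, 0, boxSupportDom_zero, by simp [Matrix.row_def], by simp⟩
      · exact ⟨-Pi.single i 1, 0, boxSupportDom_zero, by simp [neg_vecMul, Matrix.row_def], by simp⟩
      · refine ⟨0, Pi.single j (-1), fun i => ?_, ?_, ?_⟩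
        · by_cases h : i = j
          · subst h; simpa using hj
          · simp [h]
        · ext i
          by_cases h : i = j
          · subst h; simp
          · simp [h]
        · rw [boxSupport_single]; norm_num
      · refine ⟨0, Pi.single j 1, fun i => ?_, ?_, ?_⟩
        · by_cases h : i = j
          · subst h; simpa using hj
          · simp [h]
        · ext i
          by_cases h : i = j
          · subst h; simp
          · simp [h]
        · rw [boxSupport_single]; norm_num
  obtain ⟨x, hx⟩ := hex
  refine ⟨x, fun j => ⟨fun hj => ?_, fun hj => ?_⟩, funext fun i => le_antisymm ?_ ?_⟩
  · simpa using hx (Pi.single j 1, lo j) (Or.inr (Or.inl ⟨j, hj, rfl⟩))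
  · simpa using hx (Pi.single j (-1), -hi j) (Or.inr (Or.inr ⟨j, hj, rfl⟩))
  · exact hx (Q i, z i) (Or.inl (Or.inl ⟨i, rfl⟩))
  · have := hx (-Q i, -z i) (Or.inl (Or.inr ⟨i, rfl⟩))
    rw [neg_dotProduct, neg_le_neg_iff] at this
    exact this

end VecMul

theorem RespectsIntBounds.sign {k : Type} {r s : k → ℚ} (h : RespectsIntBounds r s) (j : k) :
    (0 ≤ r j → 0 ≤ s j) ∧ (r j ≤ 0 → s j ≤ 0) := by
  simpa using h j 0

theorem RespectsIntBounds.sign_intCast_add {k : Type} {r s : k → ℚ} (h : RespectsIntBounds r s)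
    (c : k → ℤ) (j : k) :
    (0 ≤ c j + r j → 0 ≤ c j + s j) ∧ (c j + r j ≤ 0 → c j + s j ≤ 0) := by
  have := h j (-c j)
  push_cast at this
  exact ⟨fun h' => by linarith [this.1 (by linarith)], fun h' => by linarith [this.2 (by linarith)]⟩

theorem vecMul_boxMatrix {ι κ : Type} [Fintype ι] [Fintype κ] [DecidableEq κ]
    (A : Matrix ι κ ℚ) (y : ι ⊕ (κ ⊕ κ) → ℚ) (i : κ) :
    (y ᵥ* boxMatrix A) i =
      ∑ a, y (Sum.inl a) * A a i + (y (Sum.inr (Sum.inl i)) - y (Sum.inr (Sum.inr i))) := by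
  simp [vecMul, dotProduct, Fintype.sum_sum_type, boxMatrix, sub_eq_add_neg]

theorem dotProduct_boxRHS {ι κ : Type} [Fintype ι] [Fintype κ]
    (b : ι → ℚ) (f g : κ → ℚ) (y : ι ⊕ (κ ⊕ κ) → ℚ) :
    y ⬝ᵥ boxRHS b f g = ∑ a, y (Sum.inl a) * b a +
      ∑ i, (y (Sum.inr (Sum.inl i)) * f i - y (Sum.inr (Sum.inr i)) * g i) := by
  simp [dotProduct, Fintype.sum_sum_type, boxRHS, sub_eq_add_neg, Finset.sum_add_distrib]

section TotallyUnimodular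

variable {k l : Type} [Fintype k] [Fintype l] {Q : Matrix l k ℚ}
  {L U : k → Prop} {lo hi : k → ℚ} {ι : Type} [Fintype ι] {v : ι → l → ℚ}

/-- The concave objective `-h (π Q) - h' (c + π)`, built from support functions of boxes, does
not decrease under a suitable integral rounding of `π`. -/
theorem exists_integral_boxSupport_le (hQ : Q.IsTotallyUnimodular) (lo hi : k → ℚ)
    (lo' hi' : l → ℚ) (c : l → ℤ) {π : l → ℚ} (hπ : BoxSupportDom L U (π ᵥ* Q)) :
    ∃ π' : l → ℚ, (∀ i, π' i ∈ ratIntegers) ∧ BoxSupportDom L U (π' ᵥ* Q) ∧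
      boxSupport lo hi (π' ᵥ* Q) + boxSupport lo' hi' (fun i => c i + π' i) ≤
        boxSupport lo hi (π ᵥ* Q) + boxSupport lo' hi' (fun i => c i + π i) := by
  let σ : k → ℚ := fun j => if 0 ≤ (π ᵥ* Q) j then hi j else lo j
  let τ : l → ℚ := fun i => if 0 ≤ c i + π i then hi' i else lo' i
  obtain ⟨π', hπint, h1, h2, hw⟩ := hQ.exists_rounding_vecMul (-(Q *ᵥ σ) - τ) π
  refine ⟨π', hπint, hπ.of_sign h2.sign, ?_⟩
  rw [boxSupport_eq_self (r := π ᵥ* Q), boxSupport_eq_self (r := fun i => c i + π i),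
    boxSupport_eq_of_sign h2.sign, boxSupport_eq_of_sign (r := fun i => c i + π i)
      (s := fun i => c i + π' i) (h1.sign_intCast_add c)]
  change (π' ᵥ* Q) ⬝ᵥ σ + ((fun i => (c i : ℚ)) + π') ⬝ᵥ τ ≤
    (π ᵥ* Q) ⬝ᵥ σ + ((fun i => (c i : ℚ)) + π) ⬝ᵥ τ
  rw [sub_dotProduct, sub_dotProduct, neg_dotProduct, neg_dotProduct,
    dotProduct_comm _ π, dotProduct_comm _ π, dotProduct_comm _ π', dotProduct_comm _ π',
    dotProduct_mulVec, dotProduct_mulVec] at hw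
  rw [add_dotProduct, add_dotProduct]
  linarith

variable [DecidableEq l]

/-- The system describing the image of a box under a totally unimodular matrix is box-TDI. -/
theorem isBoxTDI_boxImage (hQ : Q.IsTotallyUnimodular) (hlu : ∀ j, L j → U j → lo j ≤ hi j)
    (hlo : ∀ j, lo j ∈ ratIntegers) (hhi : ∀ j, hi j ∈ ratIntegers)
    (hdom : ∀ a, BoxSupportDom L U (v a ᵥ* Q))
    (hv : ∀ ρ : l → ℚ, (∀ i, ρ i ∈ ratIntegers) → (∀ i, |ρ i| ≤ 1) →
      BoxSupportDom L U (ρ ᵥ* Q) → ∃ a, v a = ρ) :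
    IsBoxTDI (of fun a => -v a) (fun a => -boxSupport lo hi (v a ᵥ* Q)) := by
  intro f g hfg c ⟨y₀, hy₀, hy₀c⟩ ⟨M, hM⟩
  let F : (l → ℚ) → ℚ := fun π =>
    boxSupport lo hi (π ᵥ* Q) + boxSupport (fun i => -g i) (fun i => -f i) (fun i => c i + π i)
  have weak : ∀ y : ι ⊕ (l ⊕ l) → ℚ, 0 ≤ y →
      (y ᵥ* boxMatrix (of fun a => -v a) = fun j => (c j : ℚ)) →
      ∃ π : l → ℚ, BoxSupportDom L U (π ᵥ* Q) ∧
        y ⬝ᵥ boxRHS (fun a => -boxSupport lo hi (v a ᵥ* Q)) f g ≤ -F π := by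
    intro y hy hyc
    obtain ⟨h1, h2⟩ := boxSupport_sum_le (lo := lo) (hi := hi) hlu Finset.univ
      (y := fun a => y (Sum.inl a)) (fun a _ => hy _) (v := fun a => v a ᵥ* Q) (fun a _ => hdom a)
    have hsum : (∑ a, y (Sum.inl a) • v a) ᵥ* Q = ∑ a, y (Sum.inl a) • (v a ᵥ* Q) := by
      simp [sum_vecMul, smul_vecMul]
    refine ⟨∑ a, y (Sum.inl a) • v a, hsum ▸ h1, ?_⟩
    have hbox : boxSupport (fun i => -g i) (fun i => -f i)
        (fun i => c i + (∑ a, y (Sum.inl a) • v a) i) ≤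
        -∑ i, (y (Sum.inr (Sum.inl i)) * f i - y (Sum.inr (Sum.inr i)) * g i) := by
      rw [← Finset.sum_neg_distrib]
      refine Finset.sum_le_sum fun i _ => ?_
      have hci := congrFun hyc i
      rw [vecMul_boxMatrix] at hci
      have hs : (c i : ℚ) + (∑ a, y (Sum.inl a) • v a) i =
          y (Sum.inr (Sum.inl i)) - y (Sum.inr (Sum.inr i)) := by
        simp only [← hci, Finset.sum_apply, Pi.smul_apply, smul_eq_mul, of_apply, Pi.neg_apply,
          mul_neg, Finset.sum_neg_distrib]
        ring
      beta_reduce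
      rw [hs]
      have hp : 0 ≤ y (Sum.inr (Sum.inl i)) := hy _
      have hq : 0 ≤ y (Sum.inr (Sum.inr i)) := hy _
      have := hfg i
      split_ifs <;> nlinarith
    rw [dotProduct_boxRHS]
    dsimp only [F]
    rw [hsum]
    simp only [mul_neg, Finset.sum_neg_distrib]
    linarith
  have strong : ∀ π : l → ℚ, (∀ i, π i ∈ ratIntegers) → BoxSupportDom L U (π ᵥ* Q) →
      ∃ y : ι ⊕ (l ⊕ l) → ℚ, (∀ i, y i ∈ ratIntegers) ∧ 0 ≤ y ∧
        (y ᵥ* boxMatrix (of fun a => -v a) = fun j => (c j : ℚ)) ∧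
        y ⬝ᵥ boxRHS (fun a => -boxSupport lo hi (v a ᵥ* Q)) f g = -F π := by
    intro π hπ hπdom
    obtain ⟨y, hy1, hy2, hy3, hy4⟩ :=
      exists_integral_decomposition (lo := lo) (hi := hi) hQ hv hπ hπdom
    have hcπ : ∀ i, (c i : ℚ) + π i ∈ ratIntegers := fun i => add_mem ⟨c i, rfl⟩ (hπ i)
    refine ⟨Sum.elim y (Sum.elim (fun i => if 0 ≤ c i + π i then c i + π i else 0)
      (fun i => if 0 ≤ c i + π i then 0 else -(c i + π i))), ?_, ?_, ?_, ?_⟩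
    · rintro (a | i | i)
      · exact hy1 a
      · simp only [Sum.elim_inr, Sum.elim_inl]
        split_ifs
        exacts [hcπ i, zero_mem _]
      · simp only [Sum.elim_inr]
        split_ifs
        exacts [zero_mem _, neg_mem (hcπ i)]
    · rintro (a | i | i)
      · exact hy2 a
      · simp only [Sum.elim_inr, Sum.elim_inl, Pi.zero_apply]
        split_ifs with h
        exacts [h, le_rfl]
      · simp only [Sum.elim_inr, Pi.zero_apply]
        split_ifs with h
        exacts [le_rfl, neg_nonneg.2 (not_le.1 h).le]
    · ext i
      have h3 : ∑ a, y a * v a i = π i := by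
        simpa [Finset.sum_apply] using congrFun hy3 i
      rw [vecMul_boxMatrix]
      simp only [Sum.elim_inr, Sum.elim_inl, of_apply, Pi.neg_apply, mul_neg,
        Finset.sum_neg_distrib, h3]
      split_ifs <;> ring
    · rw [dotProduct_boxRHS]
      dsimp only [F]
      simp only [Sum.elim_inr, Sum.elim_inl, mul_neg, Finset.sum_neg_distrib, hy4]
      rw [neg_add, add_right_inj, boxSupport, ← Finset.sum_neg_distrib]
      refine Finset.sum_congr rfl fun i _ => ?_
      split_ifs <;> ring
  obtain ⟨D, hD, hDfg⟩ := exists_nat_mul_mem_ratIntegers (Sum.elim f g)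
  have hD' : (0 : ℚ) < D := by exact_mod_cast hD
  have hFint : ∀ π : l → ℚ, (∀ i, π i ∈ ratIntegers) → (D : ℚ) * -F π ∈ ratIntegers := by
    intro π hπ
    have h1 := boxSupport_mem_ratIntegers hlo hhi (vecMul_mem_ratIntegers hQ hπ)
    have h2 : (D : ℚ) * boxSupport (fun i => -g i) (fun i => -f i) (fun i => c i + π i)
        ∈ ratIntegers := by
      rw [boxSupport, Finset.mul_sum]
      refine sum_mem fun i _ => ?_
      have hi : (c i : ℚ) + π i ∈ ratIntegers := add_mem ⟨c i, rfl⟩ (hπ i)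
      split_ifs
      · have := mul_mem hi (neg_mem (hDfg (Sum.inl i)))
        convert this using 1
        simp only [Sum.elim_inl]
        ring
      · have := mul_mem hi (neg_mem (hDfg (Sum.inr i)))
        convert this using 1
        simp only [Sum.elim_inr]
        ring
    rw [mul_neg, mul_add]
    exact neg_mem (add_mem (mul_mem (natCast_mem _ D) h1) h2)
  let P : ℤ → Prop := fun z => ∃ π : l → ℚ, (∀ i, π i ∈ ratIntegers) ∧
    BoxSupportDom L U (π ᵥ* Q) ∧ (D : ℚ) * -F π = z
  have attain : ∀ π : l → ℚ, BoxSupportDom L U (π ᵥ* Q) → ∃ z, P z ∧ (D : ℚ) * -F π ≤ z := by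
    intro π hπ
    obtain ⟨π', hπint, hdom', hle⟩ := exists_integral_boxSupport_le hQ lo hi
      (fun i => -g i) (fun i => -f i) c hπ
    obtain ⟨z, hz⟩ := mem_ratIntegers.1 (hFint π' hπint)
    refine ⟨z, ⟨π', hπint, hdom', hz⟩, ?_⟩
    rw [← hz]
    exact mul_le_mul_of_nonneg_left (neg_le_neg hle) hD'.le
  have hbdd : ∃ b : ℤ, ∀ z, P z → z ≤ b := by
    refine ⟨⌈D * M⌉, ?_⟩
    rintro z ⟨π, hπint, hdom', hz⟩
    obtain ⟨y, -, hy, hyc, hyF⟩ := strong π hπint hdom'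
    have h1 : -F π ≤ M := hyF ▸ hM y hy hyc
    have h2 : (z : ℚ) ≤ D * M := hz ▸ mul_le_mul_of_nonneg_left h1 hD'.le
    exact_mod_cast h2.trans (Int.le_ceil _)
  have hne : ∃ z, P z := by
    obtain ⟨π, hπ, -⟩ := weak y₀ hy₀ hy₀c
    obtain ⟨z, hz, -⟩ := attain π hπ
    exact ⟨z, hz⟩
  obtain ⟨z, ⟨π, hπint, hπdom, hz⟩, hmax⟩ := Int.exists_greatest_of_bdd hbdd hne
  obtain ⟨y, hyint, hy, hyc, hyF⟩ := strong π hπint hπdom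
  refine ⟨y, fun i => mem_ratIntegers.1 (hyint i), hy, hyc, fun y' hy' hyc' => ?_⟩
  obtain ⟨π', hπ', hle⟩ := weak y' hy' hyc'
  obtain ⟨z', hz', hle'⟩ := attain π' hπ'
  rw [hyF]
  refine hle.trans (le_of_mul_le_mul_left (hle'.trans ?_) hD')
  rw [hz]
  exact_mod_cast hmax z' hz'

/-- The image of an integral box under a totally unimodular matrix is a box-TDI polyhedron. -/
theorem isBoxTDIPolyhedron_boxImage (hQ : Q.IsTotallyUnimodular)
    (hlu : ∀ j, L j → U j → lo j ≤ hi j)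
    (hlo : ∀ j, lo j ∈ ratIntegers) (hhi : ∀ j, hi j ∈ ratIntegers) :
    IsBoxTDIPolyhedron {z : l → ℚ | ∃ x : k → ℚ,
      (∀ j, (L j → lo j ≤ x j) ∧ (U j → x j ≤ hi j)) ∧ z = Q *ᵥ x} := by
  let T : Set (l → ℚ) := {ρ | (∀ i, ρ i ∈ ratIntegers) ∧ (∀ i, |ρ i| ≤ 1) ∧
    BoxSupportDom L U (ρ ᵥ* Q)}
  have hT : T.Finite := by
    refine (Set.Finite.pi' (t := fun _ : l => ({-1, 0, 1} : Set ℚ))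
      fun _ => Set.toFinite _).subset ?_
    rintro ρ ⟨h1, h2, -⟩ i
    obtain ⟨z, hz⟩ := mem_ratIntegers.1 (h1 i)
    have h3 := h2 i
    rw [hz] at h3 ⊢
    have h4 : |z| ≤ 1 := by exact_mod_cast h3
    rw [abs_le] at h4
    obtain rfl | rfl | rfl : z = -1 ∨ z = 0 ∨ z = 1 := by omega
    all_goals simp
  have := hT.to_subtype
  obtain ⟨N, ⟨e⟩⟩ := Finite.exists_equiv_fin T
  have hdom : ∀ a, BoxSupportDom L U ((e.symm a : l → ℚ) ᵥ* Q) := fun a => (e.symm a).2.2.2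
  have hv : ∀ ρ : l → ℚ, (∀ i, ρ i ∈ ratIntegers) → (∀ i, |ρ i| ≤ 1) →
      BoxSupportDom L U (ρ ᵥ* Q) → ∃ a, (e.symm a : l → ℚ) = ρ :=
    fun ρ h1 h2 h3 => ⟨e ⟨ρ, h1, h2, h3⟩, by simp⟩
  refine ⟨N, of fun a => -(e.symm a : l → ℚ),
    fun a => -boxSupport lo hi ((e.symm a : l → ℚ) ᵥ* Q), ?_,
    isBoxTDI_boxImage hQ hlu hlo hhi hdom hv⟩
  ext z
  rw [Set.mem_ofPred_eq, mem_boxImage_iff hQ hlu hdom hv]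
  refine forall_congr' fun a => ?_
  rw [← neg_le_neg_iff, ← neg_dotProduct]
  rfl

/-- The image of an integral box with possibly infinite bounds under a totally unimodular matrix
is a box-TDI polyhedron. -/
theorem isBoxTDIPolyhedron_image_of_ereal_bounds (hQ : Q.IsTotallyUnimodular) (f g : k → EReal)
    (hf : ∀ j, f j = ⊥ ∨ ∃ z : ℤ, f j = ((z : ℝ) : EReal))
    (hg : ∀ j, g j = ⊤ ∨ ∃ z : ℤ, g j = ((z : ℝ) : EReal)) (hfg : f ≤ g) :
    IsBoxTDIPolyhedron {z : l → ℚ | ∃ x : k → ℚ,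
      (∀ j, f j ≤ ((x j : ℝ) : EReal) ∧ ((x j : ℝ) : EReal) ≤ g j) ∧ z = Q *ᵥ x} := by
  have hf' : ∀ j, ∃ z : ℤ, f j ≠ ⊥ → f j = ((z : ℝ) : EReal) := fun j => by
    rcases hf j with h | ⟨z, hz⟩
    exacts [⟨0, fun h' => absurd h h'⟩, ⟨z, fun _ => hz⟩]
  have hg' : ∀ j, ∃ z : ℤ, g j ≠ ⊤ → g j = ((z : ℝ) : EReal) := fun j => by
    rcases hg j with h | ⟨z, hz⟩
    exacts [⟨0, fun h' => absurd h h'⟩, ⟨z, fun _ => hz⟩]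
  choose lo hlo using hf'
  choose hi hhi using hg'
  have hlu : ∀ j, f j ≠ ⊥ → g j ≠ ⊤ → (lo j : ℚ) ≤ hi j := by
    intro j hL hU
    have := hfg j
    rw [hlo j hL, hhi j hU, EReal.coe_le_coe_iff] at this
    exact_mod_cast this
  have key := isBoxTDIPolyhedron_boxImage hQ hlu (fun j => ⟨lo j, rfl⟩) (fun j => ⟨hi j, rfl⟩)
  have hlower : ∀ j (q : ℚ), f j ≤ ((q : ℝ) : EReal) ↔ (f j ≠ ⊥ → (lo j : ℚ) ≤ q) := by
    intro j q
    by_cases h : f j = ⊥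
    · simp [h]
    · simp only [ne_eq, h, not_false_eq_true, forall_const]
      rw [hlo j h, EReal.coe_le_coe_iff]
      norm_cast
  have hupper : ∀ j (q : ℚ), ((q : ℝ) : EReal) ≤ g j ↔ (g j ≠ ⊤ → q ≤ (hi j : ℚ)) := by
    intro j q
    by_cases h : g j = ⊤
    · simp [h]
    · simp only [ne_eq, h, not_false_eq_true, forall_const]
      rw [hhi j h, EReal.coe_le_coe_iff]
      norm_cast
  simpa only [hlower, hupper] using key

end TotallyUnimodular

/-- Let `Q` be totally unimodular and `f ≤ g` integer-valued bounding
vectors possibly with `-∞` resp. `+∞` components (encoded in the extended reals). Then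
`R' = {z : z = Q x for some x with f ≤ x ≤ g}` is a box-TDI polyhedron; analogously,
for integer-valued bounds `ℓ ≤ u`, the polyhedron `R'' = {w : w = y Q, ℓ ≤ y ≤ u}`
is box-TDI. -/
theorem TU_image_boxTDI {m n : ℕ} (Q : Matrix (Fin m) (Fin n) ℚ)
    (hTU : Q.IsTotallyUnimodular)
    (f g : Fin n → EReal)
    (hf : ∀ j, f j = ⊥ ∨ ∃ k : ℤ, f j = ((k : ℝ) : EReal))
    (hg : ∀ j, g j = ⊤ ∨ ∃ k : ℤ, g j = ((k : ℝ) : EReal))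
    (hfg : f ≤ g)
    (ℓ u : Fin m → EReal)
    (hℓ : ∀ i, ℓ i = ⊥ ∨ ∃ k : ℤ, ℓ i = ((k : ℝ) : EReal))
    (hu : ∀ i, u i = ⊤ ∨ ∃ k : ℤ, u i = ((k : ℝ) : EReal))
    (hℓu : ℓ ≤ u) :
    IsBoxTDIPolyhedron {z : Fin m → ℚ | ∃ x : Fin n → ℚ,
      (∀ j, f j ≤ ((x j : ℝ) : EReal) ∧ ((x j : ℝ) : EReal) ≤ g j) ∧ z = Q *ᵥ x} ∧
    IsBoxTDIPolyhedron {w : Fin n → ℚ | ∃ y : Fin m → ℚ,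
      (∀ i, ℓ i ≤ ((y i : ℝ) : EReal) ∧ ((y i : ℝ) : EReal) ≤ u i) ∧ w = y ᵥ* Q} := by
  refine ⟨isBoxTDIPolyhedron_image_of_ereal_bounds hTU f g hf hg hfg, ?_⟩
  simpa only [mulVec_transpose] using
    isBoxTDIPolyhedron_image_of_ereal_bounds hTU.transpose ℓ u hℓ hu hℓu
end

section
/- Let B := B'(p) be an integral base-polyhedron on a finite ground set S defined by an integer-valued supermodular function p, with ⊙B := B ∩ ℤ^S nonempty. Then min{z² : z ∈ ⊙B} = max{p̂(w) − Σ_{s∈S} ⌊w(s)/2⌋·⌈w(s)/2⌉ : w ∈ ℤ^S}, where z² := Σ_{s∈S} z(s)² and p̂ is the linear (Lovász) extension of p. Moreover, if B₁ := B'(p₁) and B₂ := B'(p₂) are integral base-polyhedra with B := B₁ ∩ B₂ nonempty, then min{z² : z ∈ B ∩ ℤ^S} = max{p̂₁(w₁) + p̂₂(w₂) − Σ_{s∈S} ⌊(w₁(s)+w₂(s))/2⌋·⌈(w₁(s)+w₂(s))/2⌉ : w₁, w₂ ∈ ℤ^S}. -/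
open Matrix

/-- `p : 2^S → ℤ ∪ {-∞}` (encoded in the extended reals) is supermodular. -/
def Supermodular {n : ℕ} (p : Finset (Fin n) → EReal) : Prop :=
  ∀ X Y : Finset (Fin n), p X + p Y ≤ p (X ∩ Y) + p (X ∪ Y)

/-- Membership in the base-polyhedron `B'(p)`:
`x̃(Z) ≥ p(Z)` for every `Z ⊆ S` and `x̃(S) = p(S)`. -/
def memBase {n : ℕ} (p : Finset (Fin n) → EReal) (x : Fin n → ℚ) : Prop :=
  (∀ Z : Finset (Fin n), p Z ≤ (((∑ s ∈ Z, x s : ℚ) : ℝ) : EReal)) ∧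
    (((∑ s, x s : ℚ) : ℝ) : EReal) = p Finset.univ

/-- The linear (Lovász) extension `p̂(w)` of `p` at an integral vector `w`:
`p̂(w) = p(S_n) w(s_n) + Σ_{j<n-1} p(S_{j+1})(w(s_{j+1}) - w(s_{j+2}))` where the elements
are indexed so that `w(s_1) ≥ … ≥ w(s_n)` and `S_j` consists of the `j` largest ones; a term
with vanishing difference is `0` even if the corresponding `p`-value is `-∞` (this is the
convention of multiplication by `0` in `EReal`). -/
noncomputable def lovasz {n : ℕ} (p : Finset (Fin n) → EReal) (w : Fin n → ℤ) : EReal :=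
  if h : n = 0 then 0
  else
    let e : Equiv.Perm (Fin n) := Tuple.sort fun i => (-(w i) : ℤ)
    p Finset.univ * (((w (e ⟨n - 1, by omega⟩) : ℤ) : ℝ) : EReal) +
      ∑ j : Fin (n - 1),
        p ((Finset.univ.filter fun i : Fin n => (i : ℕ) ≤ (j : ℕ)).image fun i => e i) *
          (((w (e ⟨(j : ℕ), by have := j.isLt; omega⟩) -
              w (e ⟨(j : ℕ) + 1, by have := j.isLt; omega⟩) : ℤ) : ℝ) : EReal)

/-- The inclusion of `ℤ ∪ {+∞}` into the extended reals. -/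
noncomputable def wtop : WithTop ℤ → EReal :=
  WithTop.recTopCoe ⊤ fun k => ((k : ℝ) : EReal)

/-- The discrete conjugate `φ•(ℓ) = sup {kℓ - φ(k) : k ∈ ℤ}`, valued in the extended reals. -/
noncomputable def discreteConj (φ : ℤ → WithTop ℤ) (l : ℤ) : EReal :=
  ⨆ k : ℤ, (((k * l : ℤ) : ℝ) : EReal) - wtop (φ k)

/-- `⌊w/2⌋ ⌈w/2⌉` for an integer `w`. -/
def halfProd (w : ℤ) : ℤ := (Int.fdiv w 2) * (Int.fdiv (w + 1) 2)

/-- **Farkas' lemma** over `ℚ`: a functional that is nonnegative wherever finitely many given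
functionals are nonnegative is a nonnegative combination of them. -/
theorem exists_nonneg_combination {V ι : Type*} [AddCommGroup V] [Module ℚ V]
    (t : Finset ι) (a : ι → V →ₗ[ℚ] ℚ) (b : V →ₗ[ℚ] ℚ)
    (h : ∀ v, (∀ i ∈ t, 0 ≤ a i v) → 0 ≤ b v) :
    ∃ c : ι → ℚ, (∀ i, 0 ≤ c i) ∧ b = ∑ i ∈ t, c i • a i := by
  classical
  induction t using Finset.induction_on generalizing a b with
  | empty =>
    refine ⟨0, fun _ => le_rfl, ?_⟩
    ext v
    have h₁ := h v (by simp)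
    have h₂ := h (-v) (by simp)
    simp only [map_neg] at h₂
    simp only [Finset.sum_empty, LinearMap.zero_apply]
    linarith
  | insert j t hj ih =>
    by_cases hb : ∀ v, (∀ i ∈ t, 0 ≤ a i v) → 0 ≤ b v
    · obtain ⟨c, hc, hbc⟩ := ih a b hb
      refine ⟨fun i => if i = j then 0 else c i, fun i => by dsimp only; split_ifs <;> simp [hc], ?_⟩
      rw [Finset.sum_insert hj, hbc]
      simp only [if_true, zero_smul, zero_add]
      exact Finset.sum_congr rfl fun i hi => by rw [if_neg (by rintro rfl; exact hj hi)]
    · push Not at hb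
      obtain ⟨v₀, hv₀, hbv₀⟩ := hb
      have hjv₀ : a j v₀ < 0 := by
        by_contra! hcon
        exact absurd (h v₀ (by simpa [hcon] using hv₀)) (not_le.2 hbv₀)
      obtain ⟨x, hx, hbx, hjx⟩ : ∃ x, (∀ i ∈ t, 0 ≤ a i x) ∧ b x < 0 ∧ a j x = -1 := by
        refine ⟨(-(a j v₀))⁻¹ • v₀, fun i hi => ?_, ?_, ?_⟩
        · have := hv₀ i hi
          have h' : 0 < (-(a j v₀))⁻¹ := inv_pos.2 (by linarith)
          simpa using mul_nonneg h'.le this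
        · have h' : 0 < (-(a j v₀))⁻¹ := inv_pos.2 (by linarith)
          simpa using mul_neg_of_pos_of_neg h' hbv₀
        · have : a j v₀ ≠ 0 := hjv₀.ne
          simp only [map_smul, smul_eq_mul]
          field_simp
      obtain ⟨c, hc, hbc⟩ := ih (fun i => a i + a i x • a j) (b + b x • a j) (by
        intro v hv
        have := h (v + a j v • x) (by
          intro i hi
          rcases Finset.mem_insert.1 hi with rfl | hi
          · simp [hjx]
          · have := hv i hi
            simp only [LinearMap.add_apply, LinearMap.smul_apply, smul_eq_mul] at this
            simp only [map_add, map_smul, smul_eq_mul]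
            linarith)
        simp only [map_add, map_smul, smul_eq_mul] at this
        simp only [LinearMap.add_apply, LinearMap.smul_apply, smul_eq_mul]
        linarith)
      have hnn : 0 ≤ ∑ i ∈ t, c i * a i x :=
        Finset.sum_nonneg fun i hi => mul_nonneg (hc i) (hx i hi)
      refine ⟨fun i => if i = j then ∑ i ∈ t, c i * a i x - b x else c i, fun i => ?_, ?_⟩
      · dsimp only
        split_ifs
        · linarith
        · exact hc i
      · rw [Finset.sum_insert hj]
        simp only [if_true]
        rw [Finset.sum_congr rfl (g := fun i => c i • a i)
          fun i hi => by rw [if_neg (by rintro rfl; exact hj hi)]]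
        ext v
        have hv := LinearMap.congr_fun hbc v
        simp only [LinearMap.add_apply, LinearMap.sum_apply, LinearMap.smul_apply, smul_eq_mul,
          mul_add, Finset.sum_add_distrib, ← mul_assoc, ← Finset.sum_mul] at hv ⊢
        linarith

/-- Moving in a feasible direction that is not a recession direction, one can go as far as to hit
a new constraint. -/
theorem exists_step_to_new_tight {V ι : Type*} [AddCommGroup V] [Module ℚ V] [Finite ι]
    (a : ι → V →ₗ[ℚ] ℚ) (b : ι → ℚ) (x d : V) (hx : ∀ i, b i ≤ a i x)
    (hd : ∀ i, a i x = b i → 0 ≤ a i d) (hneg : ∃ i, a i d < 0) :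
    ∃ ε : ℚ, 0 < ε ∧ (∀ i, b i ≤ a i (x + ε • d)) ∧
      ∃ i, a i x ≠ b i ∧ a i (x + ε • d) = b i := by
  classical
  have := Fintype.ofFinite ι
  obtain ⟨i₀, hi₀⟩ := hneg
  obtain ⟨j, hj, hmin⟩ := Finset.exists_min_image (Finset.univ.filter fun i => a i d < 0)
    (fun i => (a i x - b i) / -(a i d)) ⟨i₀, by simpa using hi₀⟩
  simp only [Finset.mem_filter, Finset.mem_univ, true_and] at hj hmin
  have hslack : a j x ≠ b j := fun h => absurd (hd j h) (not_le.2 hj)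
  have hpos : 0 < (a j x - b j) / -(a j d) :=
    div_pos (sub_pos.2 (lt_of_le_of_ne (hx j) hslack.symm)) (by linarith)
  refine ⟨_, hpos, fun i => ?_, j, hslack, ?_⟩
  · simp only [map_add, map_smul, smul_eq_mul]
    rcases lt_or_ge (a i d) 0 with hi | hi
    · have := hmin i hi
      rw [le_div_iff₀ (by linarith)] at this
      linarith
    · have := mul_nonneg hpos.le hi
      linarith [hx i]
  · have : a j d ≠ 0 := hj.ne
    simp only [map_add, map_smul, smul_eq_mul]
    field_simp
    ring

theorem exists_pos_step {V ι : Type*} [AddCommGroup V] [Module ℚ V] [Finite ι]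
    (a : ι → V →ₗ[ℚ] ℚ) (b : ι → ℚ) (x d : V) (hx : ∀ i, b i ≤ a i x)
    (hd : ∀ i, a i x = b i → 0 ≤ a i d) :
    ∃ ε : ℚ, 0 < ε ∧ ∀ i, b i ≤ a i (x + ε • d) := by
  by_cases hneg : ∃ i, a i d < 0
  · obtain ⟨ε, hε, h, -⟩ := exists_step_to_new_tight a b x d hx hd hneg
    exact ⟨ε, hε, h⟩
  · push Not at hneg
    refine ⟨1, one_pos, fun i => ?_⟩
    simp only [map_add, one_smul]
    linarith [hx i, hneg i]

/-- If every feasible point that is not `good` admits a direction along which the tight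
constraints stay tight, some constraint decreases and the cost does not increase, then from each
feasible point one reaches a `good` one of no larger cost. -/
theorem exists_good_of_directions {V ι : Type*} [AddCommGroup V] [Module ℚ V] [Finite ι]
    (a : ι → V →ₗ[ℚ] ℚ) (b : ι → ℚ) (c : V →ₗ[ℚ] ℚ) (good : V → Prop)
    (hdir : ∀ x, (∀ i, b i ≤ a i x) → ¬ good x →
      ∃ d, (∀ i, a i x = b i → a i d = 0) ∧ (∃ i, a i d < 0) ∧ c d ≤ 0)
    (x : V) (hx : ∀ i, b i ≤ a i x) :
    ∃ y, (∀ i, b i ≤ a i y) ∧ good y ∧ c y ≤ c x := by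
  classical
  have := Fintype.ofFinite ι
  induction hN : (Finset.univ.filter fun i => a i x ≠ b i).card using Nat.strong_induction_on
    generalizing x with
  | _ N ih =>
    by_cases hg : good x
    · exact ⟨x, hx, hg, le_rfl⟩
    obtain ⟨d, hd, hneg, hcd⟩ := hdir x hx hg
    obtain ⟨ε, hε, hfeas, j, hj, hj'⟩ :=
      exists_step_to_new_tight a b x d hx (fun i hi => (hd i hi).ge) hneg
    obtain ⟨y, hy, hgy, hcy⟩ := ih _ (by
      rw [← hN]
      refine Finset.card_lt_card (Finset.ssubset_iff_of_subset ?_ |>.2 ⟨j, by simpa using hj, ?_⟩)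
      · intro i
        simp only [Finset.mem_filter, Finset.mem_univ, true_and]
        intro hi hi'
        exact hi (by simp [hi', hd i hi'])
      · simpa using hj') (x + ε • d) hfeas rfl
    refine ⟨y, hy, hgy, hcy.trans ?_⟩
    simp only [map_add, map_smul, smul_eq_mul]
    linarith [mul_nonpos_of_nonneg_of_nonpos hε.le hcd]

/-- Two maps on a nonempty finite set `F`, neither of which has a fibre of size one, admit a common
nonzero weighting of `F` that sums to zero on all their fibres. -/
theorem exists_ne_zero_sum_fiber_eq_zero {ι α : Type*} [Fintype ι] [DecidableEq ι]
    [DecidableEq α] (f g : ι → α) (F : Finset ι) (hF : F.Nonempty)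
    (hf : ∀ s ∈ F, ∃ t ∈ F, t ≠ s ∧ f t = f s) (hg : ∀ s ∈ F, ∃ t ∈ F, t ≠ s ∧ g t = g s) :
    ∃ d : ι → ℚ, (∃ s, d s ≠ 0) ∧ (∀ s ∉ F, d s = 0) ∧
      (∀ k, ∑ s with f s = k, d s = 0) ∧ (∀ k, ∑ s with g s = k, d s = 0) := by
  have card (f : ι → α)
      (hf : ∀ s ∈ F, ∃ t ∈ F, t ≠ s ∧ f t = f s) : 2 * (F.image f).card ≤ F.card := by
    rw [mul_comm, Finset.card_eq_sum_card_image f F, ← smul_eq_mul]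
    refine Finset.card_nsmul_le_sum _ _ _ fun k hk => ?_
    obtain ⟨s, hs, rfl⟩ := Finset.mem_image.1 hk
    obtain ⟨t, ht, hts, hfts⟩ := hf s hs
    exact Finset.one_lt_card.2 ⟨t, by simp [ht, hfts], s, by simp [hs], hts⟩
  let ext : (F → ℚ) → ι → ℚ := fun d s => if h : s ∈ F then d ⟨s, h⟩ else 0
  have hsum (d : F → ℚ) (P : ι → Prop) [DecidablePred P] :
      ∑ s with P s, ext d s = ∑ s : F, if P s then d s else 0 := by
    rw [Finset.sum_filter, ← Finset.sum_subset (Finset.subset_univ F), ← Finset.sum_attach,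
      Finset.univ_eq_attach]
    · refine Finset.sum_congr rfl fun s _ => ?_
      simp [ext]
    · intro s _ hs
      simp [ext, hs]
  let L : (F → ℚ) →ₗ[ℚ] (F.image f → ℚ) × (F.image g → ℚ) :=
    { toFun := fun d => (fun k => ∑ s : F, if f s = k then d s else 0,
        fun k => ∑ s : F, if g s = k then d s else 0)
      map_add' := by
        intro d d'
        ext k <;> simp [← Finset.sum_add_distrib, ite_add_ite]
      map_smul' := by
        intro r d
        ext k <;> simp [Finset.mul_sum] }
  have hL : ¬ Function.Injective L := by
    intro hinj
    have h₁ := card f hf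
    have h₂ := card g hg
    have hdim : Module.finrank ℚ (F → ℚ) =
        Module.finrank ℚ ((F.image f → ℚ) × (F.image g → ℚ)) := by
      refine le_antisymm (LinearMap.finrank_le_finrank_of_injective hinj) ?_
      simp only [Module.finrank_prod, Module.finrank_fintype_fun_eq_card, Fintype.card_coe]
      omega
    have hsurj := (LinearMap.injective_iff_surjective_of_finrank_eq_finrank hdim).1 hinj
    obtain ⟨s, hs⟩ := hF
    obtain ⟨d, hd⟩ := hsurj (Pi.single ⟨f s, Finset.mem_image_of_mem f hs⟩ 1, 0)
    have total (f : ι → α) :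
        ∑ k : F.image f, (∑ s : F, if f s = k then d s else 0) = ∑ s : F, d s := by
      rw [Finset.sum_comm]
      refine Finset.sum_congr rfl fun s _ => ?_
      rw [Finset.sum_eq_single ⟨f s, Finset.mem_image_of_mem f s.2⟩]
      · simp
      · intro k _ hk
        exact if_neg fun h => hk (Subtype.ext h.symm)
      · simp
    have h₁ : ∑ k, (L d).1 k = 1 := by rw [hd]; simp
    have h₂ : ∑ k, (L d).2 k = 0 := by rw [hd]; simp
    have e₁ : ∑ k, (L d).1 k = ∑ s, d s := total f
    have e₂ : ∑ k, (L d).2 k = ∑ s, d s := total g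
    linarith
  rw [← LinearMap.ker_eq_bot, Submodule.eq_bot_iff] at hL
  push Not at hL
  obtain ⟨d, hd, hd0⟩ := hL
  have fiber (f : ι → α)
      (h : ∀ k : F.image f, (∑ s : F, if f s = k then d s else 0) = 0) (k : α) :
      ∑ s with f s = k, ext d s = 0 := by
    rw [hsum d fun s => f s = k]
    by_cases hk : k ∈ F.image f
    · exact h ⟨k, hk⟩
    · refine Finset.sum_eq_zero fun s _ => if_neg ?_
      rintro rfl
      exact hk (Finset.mem_image_of_mem f s.2)
  refine ⟨ext d, ?_, fun s hs => dif_neg hs, fiber f fun k => ?_, fiber g fun k => ?_⟩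
  · obtain ⟨s, hs⟩ := Function.ne_iff.1 hd0
    exact ⟨s, by simpa [ext] using hs⟩
  · exact congrFun (congrArg Prod.fst hd) k
  · exact congrFun (congrArg Prod.snd hd) k

section Lattice

variable {ι : Type*} [Fintype ι] [DecidableEq ι]

/-- The family `𝓕` of sets contains the ground set and is closed under intersection and union. -/
structure IsRingFamily (𝓕 : Finset (Finset ι)) : Prop where
  univ_mem : Finset.univ ∈ 𝓕
  inter_mem : ∀ X ∈ 𝓕, ∀ Y ∈ 𝓕, X ∩ Y ∈ 𝓕
  union_mem : ∀ X ∈ 𝓕, ∀ Y ∈ 𝓕, X ∪ Y ∈ 𝓕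

/-- The elements lying in every member of `𝓕` that contains `s`. -/
def famHull (𝓕 : Finset (Finset ι)) (s : ι) : Finset ι :=
  Finset.univ.filter fun t => ∀ T ∈ 𝓕, s ∈ T → t ∈ T

theorem mem_famHull {𝓕 : Finset (Finset ι)} {s t : ι} :
    t ∈ famHull 𝓕 s ↔ ∀ T ∈ 𝓕, s ∈ T → t ∈ T := by
  simp [famHull]

theorem self_mem_famHull (𝓕 : Finset (Finset ι)) (s : ι) : s ∈ famHull 𝓕 s :=
  mem_famHull.2 fun _ _ h => h

theorem famHull_subset_of_mem {𝓕 : Finset (Finset ι)} {s t : ι} (h : t ∈ famHull 𝓕 s) :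
    famHull 𝓕 t ⊆ famHull 𝓕 s := fun _ hr =>
  mem_famHull.2 fun T hT hs => mem_famHull.1 hr T hT (mem_famHull.1 h T hT hs)

namespace IsRingFamily

variable {𝓕 : Finset (Finset ι)} (h𝓕 : IsRingFamily 𝓕)

include h𝓕

theorem famHull_mem (s : ι) : famHull 𝓕 s ∈ 𝓕 := by
  have h : (𝓕.filter (s ∈ ·)).inf id ∈ (𝓕 : Set (Finset ι)) :=
    Finset.inf_mem _ h𝓕.univ_mem h𝓕.inter_mem _ _ fun T hT => (Finset.mem_filter.1 hT).1
  convert Finset.mem_coe.1 h using 1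
  ext t
  simp [mem_famHull, Finset.mem_inf]

theorem sup_eq_empty_or_mem {κ : Type*} (t : Finset κ) (g : κ → Finset ι)
    (hg : ∀ k ∈ t, g k ∈ 𝓕) : t.sup g = ∅ ∨ t.sup g ∈ 𝓕 := by
  refine Finset.sup_mem {T : Finset ι | T = ∅ ∨ T ∈ 𝓕} (Or.inl rfl) ?_ t g
    fun k hk => Or.inr (hg k hk)
  rintro X (rfl | hX) Y (rfl | hY)
  · simp
  · simp [hY]
  · simp [hX]
  · exact Or.inr (h𝓕.union_mem X hX Y hY)

/-- A function which is monotone along `famHull` has its level sets in the family. -/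
theorem level_mem {α : Type*} [LinearOrder α] (w : ι → α)
    (hw : ∀ s, ∀ t ∈ famHull 𝓕 s, w s ≤ w t) (s : ι) :
    (Finset.univ.filter fun t => w s ≤ w t) ∈ 𝓕 := by
  have hsup : (Finset.univ.filter fun t => w s ≤ w t).sup (famHull 𝓕) =
      Finset.univ.filter fun t => w s ≤ w t := by
    ext t
    simp only [Finset.mem_sup, Finset.mem_filter, Finset.mem_univ, true_and]
    exact ⟨fun ⟨r, hr, ht⟩ => hr.trans (hw r t ht), fun ht => ⟨t, ht, self_mem_famHull 𝓕 t⟩⟩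
  rcases h𝓕.sup_eq_empty_or_mem (Finset.univ.filter fun t => w s ≤ w t) (famHull 𝓕)
    (fun k _ => h𝓕.famHull_mem k) with h | h
  · rw [hsup] at h
    exact absurd h (Finset.ne_empty_of_mem (a := s) (by simp))
  · rwa [hsup] at h

/-- If all members of the family have integral sum, so have the classes of elements that it does
not separate. -/
theorem sum_class_mem_range (x : ι → ℚ)
    (hx : ∀ T ∈ 𝓕, ∑ s ∈ T, x s ∈ (Int.castAddHom ℚ).range) (s : ι) :
    ∑ t with famHull 𝓕 t = famHull 𝓕 s, x t ∈ (Int.castAddHom ℚ).range := by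
  set U := (Finset.univ.filter fun t => t ∈ famHull 𝓕 s ∧ s ∉ famHull 𝓕 t).sup (famHull 𝓕)
  have memU (t : ι) : t ∈ U ↔ t ∈ famHull 𝓕 s ∧ s ∉ famHull 𝓕 t := by
    simp only [U, Finset.mem_sup, Finset.mem_filter, Finset.mem_univ, true_and]
    refine ⟨fun ⟨r, ⟨hr, hsr⟩, ht⟩ => ⟨famHull_subset_of_mem hr ht,
      fun hst => hsr (famHull_subset_of_mem ht hst)⟩, fun h => ⟨t, h, self_mem_famHull 𝓕 t⟩⟩
  have hU : ∑ t ∈ U, x t ∈ (Int.castAddHom ℚ).range := by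
    rcases h𝓕.sup_eq_empty_or_mem (Finset.univ.filter fun t => t ∈ famHull 𝓕 s ∧ s ∉ famHull 𝓕 t)
      (famHull 𝓕) (fun k _ => h𝓕.famHull_mem k) with h | h
    · change U = ∅ at h
      rw [h, Finset.sum_empty]
      exact zero_mem _
    · exact hx _ h
  have hclass : (Finset.univ.filter fun t => famHull 𝓕 t = famHull 𝓕 s) = famHull 𝓕 s \ U := by
    ext t
    simp only [Finset.mem_filter, Finset.mem_univ, true_and, Finset.mem_sdiff, memU]
    constructor
    · intro h
      rw [← h]
      exact ⟨self_mem_famHull 𝓕 t, fun h' => h'.2 (h ▸ self_mem_famHull 𝓕 s)⟩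
    · rintro ⟨h₁, h₂⟩
      have h₃ : s ∈ famHull 𝓕 t := by tauto
      exact (famHull_subset_of_mem h₁).antisymm (famHull_subset_of_mem h₃)
  have hsub : U ⊆ famHull 𝓕 s := fun t ht => ((memU t).1 ht).1
  rw [hclass, ← add_sub_cancel_right (∑ t ∈ famHull 𝓕 s \ U, x t) (∑ t ∈ U, x t),
    Finset.sum_sdiff hsub]
  exact sub_mem (hx _ (h𝓕.famHull_mem s)) hU

/-- A nonintegral element is not alone in its class. -/
theorem exists_ne_not_mem_range (x : ι → ℚ)
    (hx : ∀ T ∈ 𝓕, ∑ s ∈ T, x s ∈ (Int.castAddHom ℚ).range) (s : ι)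
    (hs : x s ∉ (Int.castAddHom ℚ).range) :
    ∃ t, x t ∉ (Int.castAddHom ℚ).range ∧ t ≠ s ∧ famHull 𝓕 t = famHull 𝓕 s := by
  by_contra! hcon
  apply hs
  have hmem : s ∈ Finset.univ.filter fun t => famHull 𝓕 t = famHull 𝓕 s := by simp
  have hsum := h𝓕.sum_class_mem_range x hx s
  rw [← Finset.add_sum_erase _ _ hmem] at hsum
  refine (AddSubgroup.add_mem_cancel_right _ (sum_mem fun t ht => ?_)).1 hsum
  by_contra ht'
  simp only [Finset.mem_erase, Finset.mem_filter, Finset.mem_univ, true_and] at ht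
  exact hcon t ht' ht.1 ht.2

omit h𝓕 in
theorem sum_eq_zero_of_class (d : ι → ℚ)
    (hd : ∀ k, ∑ t with famHull 𝓕 t = k, d t = 0) (T : Finset ι) (hT : T ∈ 𝓕) :
    ∑ t ∈ T, d t = 0 := by
  rw [← Finset.sum_fiberwise_of_maps_to (t := T.image (famHull 𝓕)) (g := famHull 𝓕)
    fun t ht => Finset.mem_image_of_mem _ ht]
  refine Finset.sum_eq_zero fun k hk => ?_
  obtain ⟨s, hs, rfl⟩ := Finset.mem_image.1 hk
  rw [← hd (famHull 𝓕 s)]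
  refine Finset.sum_congr ?_ fun _ _ => rfl
  ext t
  simp only [Finset.mem_filter, Finset.mem_univ, true_and, and_iff_right_iff_imp]
  intro h
  exact mem_famHull.1 (h ▸ self_mem_famHull 𝓕 t) T hT hs

end IsRingFamily

/-- `f` is an integral supermodular function with domain of finiteness `𝓕`. -/
structure SupermodularOn (𝓕 : Finset (Finset ι)) (f : Finset ι → ℤ) : Prop where
  isRingFamily : IsRingFamily 𝓕
  add_le : ∀ X ∈ 𝓕, ∀ Y ∈ 𝓕, f X + f Y ≤ f (X ∩ Y) + f (X ∪ Y)

/-- Membership in the base polyhedron of the function `f` with domain of finiteness `𝓕`. -/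
structure InBase (𝓕 : Finset (Finset ι)) (f : Finset ι → ℤ) (x : ι → ℚ) : Prop where
  le_sum : ∀ T ∈ 𝓕, (f T : ℚ) ≤ ∑ s ∈ T, x s
  sum_univ : ∑ s, x s = f Finset.univ

/-- The sets whose constraint is satisfied with equality. -/
def tightSets (𝓕 : Finset (Finset ι)) (f : Finset ι → ℤ) (x : ι → ℚ) : Finset (Finset ι) :=
  𝓕.filter fun T => ∑ s ∈ T, x s = f T

omit [Fintype ι] [DecidableEq ι] in
theorem mem_tightSets {𝓕 : Finset (Finset ι)} {f : Finset ι → ℤ} {x : ι → ℚ} {T : Finset ι} :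
    T ∈ tightSets 𝓕 f x ↔ T ∈ 𝓕 ∧ ∑ s ∈ T, x s = f T := by
  simp [tightSets]

theorem SupermodularOn.isRingFamily_tightSets {𝓕 : Finset (Finset ι)} {f : Finset ι → ℤ}
    (hf : SupermodularOn 𝓕 f) {x : ι → ℚ} (hx : InBase 𝓕 f x) :
    IsRingFamily (tightSets 𝓕 f x) := by
  have key : ∀ X ∈ tightSets 𝓕 f x, ∀ Y ∈ tightSets 𝓕 f x,
      X ∩ Y ∈ tightSets 𝓕 f x ∧ X ∪ Y ∈ tightSets 𝓕 f x := by
    intro X hX Y hY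
    rw [mem_tightSets] at hX hY ⊢
    rw [mem_tightSets]
    have hi := hf.isRingFamily.inter_mem X hX.1 Y hY.1
    have hu := hf.isRingFamily.union_mem X hX.1 Y hY.1
    have h₁ := hx.le_sum _ hi
    have h₂ := hx.le_sum _ hu
    have h₃ : (f X : ℚ) + f Y ≤ f (X ∩ Y) + f (X ∪ Y) := by
      exact_mod_cast hf.add_le X hX.1 Y hY.1
    have h₄ := Finset.sum_union_inter (s₁ := X) (s₂ := Y) (f := x)
    exact ⟨⟨hi, by linarith [hX.2, hY.2]⟩, ⟨hu, by linarith [hX.2, hY.2]⟩⟩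
  exact ⟨mem_tightSets.2 ⟨hf.isRingFamily.univ_mem, hx.sum_univ⟩,
    fun X hX Y hY => (key X hX Y hY).1, fun X hX Y hY => (key X hX Y hY).2⟩

omit [Fintype ι] [DecidableEq ι] in
theorem sum_mem_range_of_mem_tightSets {𝓕 : Finset (Finset ι)} {f : Finset ι → ℤ} {x : ι → ℚ} :
    ∀ T ∈ tightSets 𝓕 f x, ∑ s ∈ T, x s ∈ (Int.castAddHom ℚ).range := fun T hT =>
  ⟨f T, (mem_tightSets.1 hT).2.symm⟩

/-- The functional `x ↦ ∑ s ∈ T, x s`. -/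
def sumOn (T : Finset ι) : (ι → ℚ) →ₗ[ℚ] ℚ := ∑ s ∈ T, LinearMap.proj s

omit [Fintype ι] [DecidableEq ι] in
@[simp] theorem sumOn_apply (T : Finset ι) (x : ι → ℚ) : sumOn T x = ∑ s ∈ T, x s := by
  simp [sumOn]

/-- A point in the intersection of two integral base polyhedra can be rounded to an integral one
without increasing a given linear cost. -/
theorem exists_integral_rounding {𝓕₁ 𝓕₂ : Finset (Finset ι)} {f₁ f₂ : Finset ι → ℤ}
    (h₁ : SupermodularOn 𝓕₁ f₁) (h₂ : SupermodularOn 𝓕₂ f₂) (c x : ι → ℚ)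
    (hx₁ : InBase 𝓕₁ f₁ x) (hx₂ : InBase 𝓕₂ f₂ x) :
    ∃ z : ι → ℤ, InBase 𝓕₁ f₁ (fun s => z s) ∧ InBase 𝓕₂ f₂ (fun s => z s) ∧
      (∀ s, ⌊x s⌋ ≤ z s ∧ z s ≤ ⌈x s⌉) ∧ ∑ s, c s * z s ≤ ∑ s, c s * x s := by
  let a : 𝓕₁ ⊕ 𝓕₂ ⊕ ι ⊕ ι ⊕ Unit → (ι → ℚ) →ₗ[ℚ] ℚ :=
    Sum.elim (fun T => sumOn T) <| Sum.elim (fun T => sumOn T) <|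
      Sum.elim (fun s => LinearMap.proj s) <| Sum.elim (fun s => -LinearMap.proj s)
        fun _ => -sumOn Finset.univ
  let b : 𝓕₁ ⊕ 𝓕₂ ⊕ ι ⊕ ι ⊕ Unit → ℚ :=
    Sum.elim (fun T => f₁ T) <| Sum.elim (fun T => f₂ T) <|
      Sum.elim (fun s => ⌊x s⌋) <| Sum.elim (fun s => -⌈x s⌉) fun _ => -f₁ Finset.univ
  have hf : (f₁ Finset.univ : ℚ) = f₂ Finset.univ := hx₁.sum_univ.symm.trans hx₂.sum_univ
  have hfeas (y : ι → ℚ) : (∀ i, b i ≤ a i y) ↔ InBase 𝓕₁ f₁ y ∧ InBase 𝓕₂ f₂ y ∧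
      ∀ s, (⌊x s⌋ : ℚ) ≤ y s ∧ y s ≤ ⌈x s⌉ := by
    simp only [Sum.forall, a, b, Sum.elim_inl, Sum.elim_inr, sumOn_apply, Subtype.forall,
      LinearMap.proj_apply, LinearMap.neg_apply, neg_le_neg_iff, forall_const]
    constructor
    · rintro ⟨h₁', h₂', h₃, h₄, h₅⟩
      have h₆ := h₁' _ h₁.isRingFamily.univ_mem
      exact ⟨⟨h₁', h₅.antisymm h₆⟩, ⟨h₂', hf ▸ h₅.antisymm h₆⟩, fun s => ⟨h₃ s, h₄ s⟩⟩
    · rintro ⟨h₁', h₂', h₃⟩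
      exact ⟨h₁'.le_sum, h₂'.le_sum, fun s => (h₃ s).1, fun s => (h₃ s).2, h₁'.sum_univ.le⟩
  obtain ⟨y, hy, hgood, hcost⟩ := exists_good_of_directions a b
    (∑ s, c s • (LinearMap.proj s : (ι → ℚ) →ₗ[ℚ] ℚ))
    (fun y => ∀ s, y s ∈ (Int.castAddHom ℚ).range) (by
      intro y hy hbad
      obtain ⟨hy₁, hy₂, -⟩ := (hfeas y).1 hy
      have hT₁ := h₁.isRingFamily_tightSets hy₁
      have hT₂ := h₂.isRingFamily_tightSets hy₂
      push Not at hbad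
      obtain ⟨s₀, hs₀⟩ := hbad
      classical
      obtain ⟨d, ⟨s, hds⟩, hoff, hd₁, hd₂⟩ := exists_ne_zero_sum_fiber_eq_zero
        (famHull (tightSets 𝓕₁ f₁ y)) (famHull (tightSets 𝓕₂ f₂ y))
        (Finset.univ.filter fun s => y s ∉ (Int.castAddHom ℚ).range)
        ⟨s₀, Finset.mem_filter.2 ⟨Finset.mem_univ _, hs₀⟩⟩
        (fun s hs => by
          obtain ⟨t, ht⟩ := hT₁.exists_ne_not_mem_range y sum_mem_range_of_mem_tightSets s
            (Finset.mem_filter.1 hs).2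
          exact ⟨t, Finset.mem_filter.2 ⟨Finset.mem_univ _, ht.1⟩, ht.2⟩)
        (fun s hs => by
          obtain ⟨t, ht⟩ := hT₂.exists_ne_not_mem_range y sum_mem_range_of_mem_tightSets s
            (Finset.mem_filter.1 hs).2
          exact ⟨t, Finset.mem_filter.2 ⟨Finset.mem_univ _, ht.1⟩, ht.2⟩)
      have hint : ∀ s, y s ∈ (Int.castAddHom ℚ).range → d s = 0 := fun s hs =>
        hoff s fun h => (Finset.mem_filter.1 h).2 hs
      have htight : ∀ i, a i y = b i → a i d = 0 := by
        simp only [Sum.forall, a, b, Sum.elim_inl, Sum.elim_inr, sumOn_apply, Subtype.forall,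
          LinearMap.proj_apply, LinearMap.neg_apply, forall_const, neg_inj, neg_eq_zero]
        refine ⟨fun T hT h => ?_, fun T hT h => ?_, fun s h => hint s ⟨_, h.symm⟩,
          fun s h => hint s ⟨_, h.symm⟩, fun _ => ?_⟩
        · exact IsRingFamily.sum_eq_zero_of_class d hd₁ T (mem_tightSets.2 ⟨hT, h⟩)
        · exact IsRingFamily.sum_eq_zero_of_class d hd₂ T (mem_tightSets.2 ⟨hT, h⟩)
        · exact IsRingFamily.sum_eq_zero_of_class d hd₁ _ hT₁.univ_mem
      have hneg : ∀ d' : ι → ℚ, d' s ≠ 0 → ∃ i, a i d' < 0 := by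
        intro d' hd'
        rcases lt_or_gt_of_ne hd' with h | h
        · exact ⟨Sum.inr (Sum.inr (Sum.inl s)), h⟩
        · exact ⟨Sum.inr (Sum.inr (Sum.inr (Sum.inl s))), by simpa [a] using h⟩
      rcases le_total ((∑ s, c s • (LinearMap.proj s : (ι → ℚ) →ₗ[ℚ] ℚ)) d) 0 with h | h
      · exact ⟨d, htight, hneg d hds, h⟩
      · refine ⟨-d, fun i hi => by rw [map_neg, htight i hi, neg_zero],
          hneg _ (by simpa using hds), by rw [map_neg]; linarith⟩)
    x ((hfeas x).2 ⟨hx₁, hx₂, fun s => ⟨Int.floor_le _, Int.le_ceil _⟩⟩)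
  choose z hz using hgood
  obtain rfl : (fun s => (z s : ℚ)) = y := funext hz
  obtain ⟨hy₁, hy₂, hbox⟩ := (hfeas _).1 hy
  refine ⟨z, hy₁, hy₂, fun s => ⟨by exact_mod_cast (hbox s).1, by exact_mod_cast (hbox s).2⟩, ?_⟩
  simpa using hcost

/-- At an integral point of minimal square sum in the intersection of two base polyhedra, no
feasible direction improves the piecewise linear extension of the square sum. -/
theorem sum_add_abs_nonneg_of_minimal {𝓕₁ 𝓕₂ : Finset (Finset ι)} {f₁ f₂ : Finset ι → ℤ}
    (h₁ : SupermodularOn 𝓕₁ f₁) (h₂ : SupermodularOn 𝓕₂ f₂) (z : ι → ℤ)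
    (hz₁ : InBase 𝓕₁ f₁ fun s => z s) (hz₂ : InBase 𝓕₂ f₂ fun s => z s)
    (hmin : ∀ y : ι → ℤ, InBase 𝓕₁ f₁ (fun s => y s) → InBase 𝓕₂ f₂ (fun s => y s) →
      ∑ s, z s ^ 2 ≤ ∑ s, y s ^ 2)
    (d : ι → ℚ) (hd₁ : ∀ T ∈ tightSets 𝓕₁ f₁ (fun s => z s), 0 ≤ ∑ s ∈ T, d s)
    (hd₂ : ∀ T ∈ tightSets 𝓕₂ f₂ (fun s => z s), 0 ≤ ∑ s ∈ T, d s) (hd : ∑ s, d s = 0) :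
    0 ≤ ∑ s, (2 * z s * d s + |d s|) := by
  by_contra! hlt
  let a : 𝓕₁ ⊕ 𝓕₂ ⊕ ι ⊕ ι → (ι → ℚ) →ₗ[ℚ] ℚ :=
    Sum.elim (fun T => sumOn T) <| Sum.elim (fun T => sumOn T) <|
      Sum.elim (fun s => LinearMap.proj s) fun s => -LinearMap.proj s
  let b : 𝓕₁ ⊕ 𝓕₂ ⊕ ι ⊕ ι → ℚ :=
    Sum.elim (fun T => f₁ T) <| Sum.elim (fun T => f₂ T) <|
      Sum.elim (fun s => z s - 1) fun s => -(z s + 1)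
  obtain ⟨ε, hε, hstep⟩ := exists_pos_step a b (fun s => (z s : ℚ)) d
    (by
      simp only [Sum.forall, a, b, Sum.elim_inl, Sum.elim_inr, sumOn_apply, Subtype.forall,
        LinearMap.proj_apply, LinearMap.neg_apply]
      exact ⟨hz₁.le_sum, hz₂.le_sum, fun s => by linarith, fun s => by linarith⟩)
    (by
      simp only [Sum.forall, a, b, Sum.elim_inl, Sum.elim_inr, sumOn_apply, Subtype.forall,
        LinearMap.proj_apply, LinearMap.neg_apply]
      exact ⟨fun T hT h => hd₁ T (mem_tightSets.2 ⟨hT, h⟩),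
        fun T hT h => hd₂ T (mem_tightSets.2 ⟨hT, h⟩), fun s h => by linarith,
        fun s h => by linarith⟩)
  set x : ι → ℚ := (fun s => (z s : ℚ)) + ε • d with hx
  have hxs (s : ι) : x s = z s + ε * d s := rfl
  simp only [Sum.forall, a, b, Sum.elim_inl, Sum.elim_inr, sumOn_apply, Subtype.forall,
    LinearMap.proj_apply, LinearMap.neg_apply] at hstep
  obtain ⟨hs₁, hs₂, hlo, hhi⟩ := hstep
  have hsum : ∑ s, x s = ∑ s, (z s : ℚ) := by
    simp [hxs, Finset.sum_add_distrib, ← Finset.mul_sum, hd]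
  let σ : ι → ℤ := fun s => SignType.sign (d s)
  have hσ (s : ι) : (σ s : ℚ) * d s = |d s| := by
    simp [σ]
  obtain ⟨y, hy₁, hy₂, hbox, hcost⟩ := exists_integral_rounding h₁ h₂
    (fun s => 2 * z s + σ s) x ⟨hs₁, hsum.trans hz₁.sum_univ⟩ ⟨hs₂, hsum.trans hz₂.sum_univ⟩
  have hsq (s : ι) : ((y s : ℚ)) ^ 2 = z s ^ 2 + (2 * z s + σ s) * (y s - z s) := by
    have hdiff : y s = z s ∨ y s = z s + σ s := by
      have hl := hlo s
      have hh := hhi s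
      rw [hxs] at hl hh
      obtain ⟨hb₁, hb₂⟩ := hbox s
      rw [hxs] at hb₁ hb₂
      rw [Int.floor_intCast_add] at hb₁
      rw [Int.ceil_intCast_add] at hb₂
      rcases lt_trichotomy (d s) 0 with h | h | h
      · have e₁ : (-1 : ℤ) ≤ ⌊ε * d s⌋ := Int.le_floor.2 (by push_cast; linarith)
        have e₂ : ⌈ε * d s⌉ ≤ 0 := Int.ceil_le.2 (by push_cast; nlinarith)
        have : σ s = -1 := by simp [σ, sign_neg h]
        omega
      · simp only [h, mul_zero, Int.floor_zero, Int.ceil_zero] at hb₁ hb₂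
        omega
      · have e₁ : (0 : ℤ) ≤ ⌊ε * d s⌋ := Int.le_floor.2 (by push_cast; nlinarith)
        have e₂ : ⌈ε * d s⌉ ≤ 1 := Int.ceil_le.2 (by push_cast; linarith)
        have : σ s = 1 := by simp [σ, sign_pos h]
        omega
    rcases hdiff with h | h
    · rw [h]; ring
    · rw [h]; push_cast; ring
  have hm : (∑ s, (z s : ℚ) ^ 2) ≤ ∑ s, (y s : ℚ) ^ 2 := by exact_mod_cast hmin y hy₁ hy₂
  have hc' : ∑ s, (2 * (z s : ℚ) + σ s) * x s =
      ∑ s, (2 * (z s : ℚ) + σ s) * z s + ε * ∑ s, (2 * z s * d s + |d s|) := by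
    rw [Finset.mul_sum, ← Finset.sum_add_distrib]
    refine Finset.sum_congr rfl fun s _ => ?_
    rw [hxs, ← hσ]
    ring
  have hy : ∑ s, (y s : ℚ) ^ 2 = ∑ s, (z s : ℚ) ^ 2 +
      (∑ s, (2 * (z s : ℚ) + σ s) * y s - ∑ s, (2 * (z s : ℚ) + σ s) * z s) := by
    rw [← Finset.sum_sub_distrib, ← Finset.sum_add_distrib]
    exact Finset.sum_congr rfl fun s _ => by rw [hsq]; ring
  have := mul_neg_of_pos_of_neg hε hlt
  linarith

/-- Dual certificate for the minimality of the square sum. -/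
theorem exists_potentials_of_minimal {𝓕₁ 𝓕₂ : Finset (Finset ι)} {f₁ f₂ : Finset ι → ℤ}
    (h₁ : SupermodularOn 𝓕₁ f₁) (h₂ : SupermodularOn 𝓕₂ f₂) (z : ι → ℤ)
    (hz₁ : InBase 𝓕₁ f₁ fun s => z s) (hz₂ : InBase 𝓕₂ f₂ fun s => z s)
    (hmin : ∀ y : ι → ℤ, InBase 𝓕₁ f₁ (fun s => y s) → InBase 𝓕₂ f₂ (fun s => y s) →
      ∑ s, z s ^ 2 ≤ ∑ s, y s ^ 2) :
    ∃ w₁ w₂ : ι → ℤ,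
      (∀ s, (Finset.univ.filter fun t => w₁ s ≤ w₁ t) ∈ tightSets 𝓕₁ f₁ fun s => z s) ∧
      (∀ s, (Finset.univ.filter fun t => w₂ s ≤ w₂ t) ∈ tightSets 𝓕₂ f₂ fun s => z s) ∧
      ∀ s, 2 * z s - 1 ≤ w₁ s + w₂ s ∧ w₁ s + w₂ s ≤ 2 * z s + 1 := by
  set 𝓣₁ := tightSets 𝓕₁ f₁ fun s => (z s : ℚ)
  set 𝓣₂ := tightSets 𝓕₂ f₂ fun s => (z s : ℚ)
  have hT₁ : IsRingFamily 𝓣₁ := h₁.isRingFamily_tightSets hz₁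
  have hT₂ : IsRingFamily 𝓣₂ := h₂.isRingFamily_tightSets hz₂
  let fst : (ι → ℚ) × (ι → ℚ) →ₗ[ℚ] (ι → ℚ) := LinearMap.fst ℚ _ _
  let snd : (ι → ℚ) × (ι → ℚ) →ₗ[ℚ] (ι → ℚ) := LinearMap.snd ℚ _ _
  let a : 𝓣₁ ⊕ 𝓣₂ ⊕ ι ⊕ ι ⊕ Unit → (ι → ℚ) × (ι → ℚ) →ₗ[ℚ] ℚ :=
    Sum.elim (fun T => sumOn (T : Finset ι) ∘ₗ (fst - snd)) <|
      Sum.elim (fun T => sumOn (T : Finset ι) ∘ₗ (fst - snd)) <|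
        Sum.elim (fun s => LinearMap.proj s ∘ₗ fst) <|
          Sum.elim (fun s => LinearMap.proj s ∘ₗ snd) fun _ => -(sumOn Finset.univ ∘ₗ (fst - snd))
  obtain ⟨c, hc, heq⟩ := exists_nonneg_combination Finset.univ a
    (∑ s, ((2 * z s + 1 : ℚ) • (LinearMap.proj s ∘ₗ fst) -
      (2 * z s - 1 : ℚ) • (LinearMap.proj s ∘ₗ snd))) (by
    rintro ⟨u, v⟩ huv
    simp only [Finset.mem_univ, forall_const, Sum.forall, a, Sum.elim_inl, Sum.elim_inr,
      LinearMap.comp_apply, LinearMap.sub_apply, fst, snd, LinearMap.fst_apply,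
      LinearMap.snd_apply, LinearMap.neg_apply, LinearMap.proj_apply, sumOn_apply,
      Subtype.forall] at huv
    obtain ⟨e₁, e₂, hu, hv, e₃⟩ := huv
    have key := sum_add_abs_nonneg_of_minimal h₁ h₂ z hz₁ hz₂ hmin (u - v) e₁ e₂
      (le_antisymm (by linarith) (e₁ _ hT₁.univ_mem))
    refine key.trans ?_
    simp only [LinearMap.sum_apply, LinearMap.sub_apply, LinearMap.smul_apply, fst, snd,
      LinearMap.comp_apply, LinearMap.fst_apply, LinearMap.snd_apply, LinearMap.proj_apply,
      smul_eq_mul]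
    refine Finset.sum_le_sum fun s _ => ?_
    have : |(u - v) s| ≤ u s + v s := by
      rw [Pi.sub_apply, abs_le]
      constructor <;> linarith [hu s, hv s]
    simp only [Pi.sub_apply] at this ⊢
    linarith)
  let μ := c (Sum.inr (Sum.inr (Sum.inr (Sum.inr ()))))
  let q₁ : ι → ℚ := fun s => ∑ T : 𝓣₁, (if s ∈ (T : Finset ι) then c (Sum.inl T) else 0) - μ
  let q₂ : ι → ℚ := fun s => ∑ T : 𝓣₂, if s ∈ (T : Finset ι) then c (Sum.inr (Sum.inl T)) else 0
  have hq₁ : ∀ s, ∀ t ∈ famHull 𝓣₁ s, q₁ s ≤ q₁ t := by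
    intro s t ht
    refine sub_le_sub_right (Finset.sum_le_sum fun T _ => ?_) _
    have := mem_famHull.1 ht T T.2
    split_ifs <;> simp_all
  have hq₂ : ∀ s, ∀ t ∈ famHull 𝓣₂ s, q₂ s ≤ q₂ t := by
    intro s t ht
    refine Finset.sum_le_sum fun T _ => ?_
    have := mem_famHull.1 ht T T.2
    split_ifs <;> simp_all
  have hupper (s : ι) : q₁ s + q₂ s ≤ 2 * z s + 1 := by
    have h := LinearMap.congr_fun heq (Pi.single s 1, 0)
    simp [a, fst, snd, Pi.single_apply] at h
    have := hc (Sum.inr (Sum.inr (Sum.inl s)))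
    simp only [q₁, q₂, μ, Finset.univ_eq_attach]
    linarith
  have hlower (s : ι) : 2 * z s - 1 ≤ q₁ s + q₂ s := by
    have h := LinearMap.congr_fun heq (0, Pi.single s 1)
    simp [a, fst, snd, Pi.single_apply] at h
    have := hc (Sum.inr (Sum.inr (Sum.inr (Sum.inl s))))
    simp only [q₁, q₂, μ, Finset.univ_eq_attach]
    linarith
  refine ⟨fun s => ⌊q₁ s⌋, fun s => ⌈q₂ s⌉,
    hT₁.level_mem _ fun s t ht => Int.floor_mono (hq₁ s t ht),
    hT₂.level_mem _ fun s t ht => Int.ceil_mono (hq₂ s t ht), fun s => ⟨?_, ?_⟩⟩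
  · have : 2 * z s - 1 - ⌈q₂ s⌉ ≤ ⌊q₁ s⌋ := by
      refine Int.le_floor.2 ?_
      push_cast
      linarith [hlower s, Int.le_ceil (q₂ s)]
    dsimp only
    omega
  · have : ⌈q₂ s⌉ ≤ 2 * z s + 1 - ⌊q₁ s⌋ := by
      refine Int.ceil_le.2 ?_
      push_cast
      linarith [hupper s, Int.floor_le (q₁ s)]
    dsimp only
    omega

/-- The minimum of the square sum over the integral points common to two base polyhedra. -/
theorem exists_minimal_of_nonempty {𝓕₁ 𝓕₂ : Finset (Finset ι)} {f₁ f₂ : Finset ι → ℤ}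
    (h₁ : SupermodularOn 𝓕₁ f₁) (h₂ : SupermodularOn 𝓕₂ f₂) (x : ι → ℚ)
    (hx₁ : InBase 𝓕₁ f₁ x) (hx₂ : InBase 𝓕₂ f₂ x) :
    ∃ z : ι → ℤ, InBase 𝓕₁ f₁ (fun s => z s) ∧ InBase 𝓕₂ f₂ (fun s => z s) ∧
      ∀ y : ι → ℤ, InBase 𝓕₁ f₁ (fun s => y s) → InBase 𝓕₂ f₂ (fun s => y s) →
        ∑ s, z s ^ 2 ≤ ∑ s, y s ^ 2 := by
  obtain ⟨z₀, hz₁, hz₂, -⟩ := exists_integral_rounding h₁ h₂ 0 x hx₁ hx₂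
  let P : Set (ι → ℤ) := {z | InBase 𝓕₁ f₁ (fun s => z s) ∧ InBase 𝓕₂ f₂ (fun s => z s)}
  obtain ⟨z, hz, hmin⟩ := (InvImage.wf (fun z : ι → ℤ => (∑ s, z s ^ 2).toNat)
    wellFounded_lt).has_min P ⟨z₀, hz₁, hz₂⟩
  refine ⟨z, hz.1, hz.2, fun y hy₁ hy₂ => ?_⟩
  have h : ¬ (∑ s, y s ^ 2).toNat < (∑ s, z s ^ 2).toNat := hmin y ⟨hy₁, hy₂⟩
  have h₀ : 0 ≤ ∑ s, y s ^ 2 := Finset.sum_nonneg fun s _ => sq_nonneg _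
  omega

end Lattice

section Lovasz

variable {n : ℕ}

/-- The sets on which `p` is finite. -/
noncomputable def finDom (p : Finset (Fin n) → EReal) : Finset (Finset (Fin n)) :=
  open Classical in Finset.univ.filter fun X => p X ≠ ⊥

theorem mem_finDom {p : Finset (Fin n) → EReal} {X : Finset (Fin n)} :
    X ∈ finDom p ↔ p X ≠ ⊥ := by
  simp [finDom]

theorem coe_rat_intCast (k : ℤ) : ((((k : ℚ) : ℝ)) : EReal) = ((k : ℝ) : EReal) := by
  rw [Rat.cast_intCast]

theorem Supermodular.supermodularOn {p : Finset (Fin n) → EReal} {f : Finset (Fin n) → ℤ}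
    (hp : Supermodular p) (hf : ∀ X, p X ≠ ⊥ → p X = ((f X : ℝ) : EReal))
    (huniv : p Finset.univ ≠ ⊥) : SupermodularOn (finDom p) f := by
  have key : ∀ X ∈ finDom p, ∀ Y ∈ finDom p, p (X ∩ Y) ≠ ⊥ ∧ p (X ∪ Y) ≠ ⊥ := by
    intro X hX Y hY
    rw [mem_finDom] at hX hY
    have h := hp X Y
    rw [hf X hX, hf Y hY, ← EReal.coe_add] at h
    constructor
    · intro h'
      rw [h', EReal.bot_add] at h
      exact EReal.coe_ne_bot _ (le_bot_iff.1 h)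
    · intro h'
      rw [h', EReal.add_bot] at h
      exact EReal.coe_ne_bot _ (le_bot_iff.1 h)
  refine ⟨⟨mem_finDom.2 huniv, fun X hX Y hY => mem_finDom.2 (key X hX Y hY).1,
    fun X hX Y hY => mem_finDom.2 (key X hX Y hY).2⟩, fun X hX Y hY => ?_⟩
  have h := hp X Y
  obtain ⟨hi, hu⟩ := key X hX Y hY
  rw [hf X (mem_finDom.1 hX), hf Y (mem_finDom.1 hY), hf _ hi, hf _ hu, ← EReal.coe_add,
    ← EReal.coe_add, EReal.coe_le_coe_iff] at h
  exact_mod_cast h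

theorem memBase_iff_inBase {p : Finset (Fin n) → EReal} {f : Finset (Fin n) → ℤ}
    (hf : ∀ X, p X ≠ ⊥ → p X = ((f X : ℝ) : EReal)) (huniv : p Finset.univ ≠ ⊥)
    (x : Fin n → ℚ) : memBase p x ↔ InBase (finDom p) f x := by
  constructor
  · rintro ⟨h₁, h₂⟩
    refine ⟨fun T hT => ?_, ?_⟩
    · have := h₁ T
      rw [hf T (mem_finDom.1 hT), ← coe_rat_intCast, EReal.coe_le_coe_iff] at this
      exact_mod_cast this
    · rw [hf _ huniv, ← coe_rat_intCast, EReal.coe_eq_coe_iff] at h₂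
      exact_mod_cast h₂
  · rintro ⟨h₁, h₂⟩
    refine ⟨fun T => ?_, ?_⟩
    · by_cases hT : p T = ⊥
      · rw [hT]
        exact bot_le
      · rw [hf T hT, ← coe_rat_intCast, EReal.coe_le_coe_iff]
        exact_mod_cast h₁ T (mem_finDom.2 hT)
    · rw [hf _ huniv, h₂, coe_rat_intCast]

theorem eq_sum_of_mem_tightSets {p : Finset (Fin n) → EReal} {f : Finset (Fin n) → ℤ}
    (hf : ∀ X, p X ≠ ⊥ → p X = ((f X : ℝ) : EReal)) {z : Fin n → ℤ} {T : Finset (Fin n)}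
    (hT : T ∈ tightSets (finDom p) f fun s => z s) :
    p T = (((∑ s ∈ T, z s : ℤ) : ℝ) : EReal) := by
  obtain ⟨h₁, h₂⟩ := mem_tightSets.1 hT
  rw [hf T (mem_finDom.1 h₁)]
  congr 2
  exact_mod_cast h₂.symm

theorem sum_range_mul_by_parts (g h : ℕ → ℤ) (m : ℕ) :
    ∑ i ∈ Finset.range (m + 1), g i * h i = (∑ i ∈ Finset.range (m + 1), h i) * g m +
      ∑ j ∈ Finset.range m, (∑ i ∈ Finset.range (j + 1), h i) * (g j - g (j + 1)) := by
  induction m with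
  | zero => simp [mul_comm]
  | succ m ih =>
    rw [Finset.sum_range_succ, ih, Finset.sum_range_succ _ (m + 1),
      Finset.sum_range_succ (fun j => (∑ i ∈ Finset.range (j + 1), h i) * (g j - g (j + 1)))]
    ring

theorem sum_mul_by_parts_perm (hn : n ≠ 0) (e : Equiv.Perm (Fin n)) (w z : Fin n → ℤ) :
    ∑ s, w s * z s = (∑ s, z s) * w (e ⟨n - 1, by omega⟩) +
      ∑ j : Fin (n - 1),
        (∑ s ∈ (Finset.univ.filter fun i : Fin n => (i : ℕ) ≤ (j : ℕ)).image fun i => e i, z s) *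
          (w (e ⟨(j : ℕ), by have := j.isLt; omega⟩) -
            w (e ⟨(j : ℕ) + 1, by have := j.isLt; omega⟩)) := by
  obtain ⟨m, rfl⟩ := Nat.exists_eq_succ_of_ne_zero hn
  let g : ℕ → ℤ := fun i => if h : i < m + 1 then w (e ⟨i, h⟩) else 0
  let h : ℕ → ℤ := fun i => if h : i < m + 1 then z (e ⟨i, h⟩) else 0
  have key := sum_range_mul_by_parts g h m
  have e₁ : ∑ i ∈ Finset.range (m + 1), g i * h i = ∑ s, w s * z s := by
    rw [Finset.sum_range, ← Equiv.sum_comp e fun s => w s * z s]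
    exact Finset.sum_congr rfl fun i _ => by simp only [g, h, dif_pos i.isLt, Fin.eta]
  have e₂ : ∑ i ∈ Finset.range (m + 1), h i = ∑ s, z s := by
    rw [Finset.sum_range, ← Equiv.sum_comp e z]
    exact Finset.sum_congr rfl fun i _ => by simp only [h, dif_pos i.isLt, Fin.eta]
  rw [e₁, e₂, Finset.sum_range] at key
  rw [key]
  congr 1
  · simp [g]
  · refine Finset.sum_congr rfl fun j _ => ?_
    have hj : (j : ℕ) < m := j.isLt
    have e₃ : ∑ s ∈ (Finset.univ.filter fun i : Fin (m + 1) => (i : ℕ) ≤ (j : ℕ)).image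
        (fun i => e i), z s = ∑ i ∈ Finset.range (j + 1), h i := by
      rw [Finset.sum_image e.injective.injOn, Finset.sum_filter]
      have : Finset.range (j + 1) = (Finset.range (m + 1)).filter fun i => i ≤ (j : ℕ) := by
        ext i
        simp only [Finset.mem_range, Finset.mem_filter]
        omega
      rw [this, Finset.sum_filter, Finset.sum_range]
      exact Finset.sum_congr rfl fun i _ => by simp only [h, dif_pos i.isLt, Fin.eta]
    have e₄ : g j = w (e ⟨j, by omega⟩) := dif_pos (by omega)
    have e₅ : g (j + 1) = w (e ⟨j + 1, by omega⟩) := dif_pos (by omega)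
    rw [e₄, e₅]
    exact congrArg (· * _) e₃.symm

theorem coe_intCast_sum {κ : Type*} (t : Finset κ) (g : κ → ℤ) :
    (((∑ k ∈ t, g k : ℤ) : ℝ) : EReal) = ∑ k ∈ t, (((g k : ℤ) : ℝ) : EReal) := by
  classical
  induction t using Finset.induction_on with
  | empty => simp
  | insert k t hk ih => rw [Finset.sum_insert hk, Finset.sum_insert hk, ← ih]; push_cast; rfl

theorem le_apply_sort (w : Fin n → ℤ) {i j : Fin n} (hij : i ≤ j) :
    w (Tuple.sort (fun i => -w i) j) ≤ w (Tuple.sort (fun i => -w i) i) := by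
  have := Tuple.monotone_sort (fun i => -w i) hij
  simpa using this

theorem sum_le_of_memBase {p : Finset (Fin n) → EReal} {z : Fin n → ℤ}
    (hz : memBase p fun s => (z s : ℚ)) (T : Finset (Fin n)) :
    p T ≤ (((∑ s ∈ T, z s : ℤ) : ℝ) : EReal) := by
  have := hz.1 T
  rwa [← Int.cast_sum, coe_rat_intCast] at this

theorem sum_univ_of_memBase {p : Finset (Fin n) → EReal} {z : Fin n → ℤ}
    (hz : memBase p fun s => (z s : ℚ)) :
    p Finset.univ = (((∑ s, z s : ℤ) : ℝ) : EReal) := by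
  have := hz.2
  rw [← Int.cast_sum, coe_rat_intCast] at this
  exact this.symm

theorem lovasz_le_of_memBase {p : Finset (Fin n) → EReal} {z : Fin n → ℤ}
    (hz : memBase p fun s => (z s : ℚ)) (w : Fin n → ℤ) :
    lovasz p w ≤ (((∑ s, w s * z s : ℤ) : ℝ) : EReal) := by
  rw [lovasz]
  split_ifs with hn
  · subst hn
    simp
  rw [sum_mul_by_parts_perm hn (Tuple.sort fun i => -w i), Int.cast_add, EReal.coe_add,
    coe_intCast_sum]
  refine add_le_add ?_ (Finset.sum_le_sum fun j _ => ?_)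
  · rw [sum_univ_of_memBase hz, ← EReal.coe_mul, ← Int.cast_mul]
  · rw [Int.cast_mul, EReal.coe_mul]
    refine mul_le_mul_of_nonneg_right (sum_le_of_memBase hz _) ?_
    have := le_apply_sort w (i := ⟨j, by have := j.isLt; omega⟩)
      (j := ⟨j + 1, by have := j.isLt; omega⟩) (by simp [Fin.le_def])
    exact_mod_cast sub_nonneg.2 this

theorem lovasz_eq_of_level_tight {p : Finset (Fin n) → EReal} {z : Fin n → ℤ}
    (hz : memBase p fun s => (z s : ℚ)) (w : Fin n → ℤ)
    (hw : ∀ s, p (Finset.univ.filter fun t => w s ≤ w t) =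
      (((∑ t with w s ≤ w t, z t : ℤ) : ℝ) : EReal)) :
    lovasz p w = (((∑ s, w s * z s : ℤ) : ℝ) : EReal) := by
  rw [lovasz]
  split_ifs with hn
  · subst hn
    simp
  rw [sum_mul_by_parts_perm hn (Tuple.sort fun i => -w i), Int.cast_add, EReal.coe_add,
    coe_intCast_sum]
  refine congrArg₂ (· + ·) ?_ ?_
  · rw [sum_univ_of_memBase hz, ← EReal.coe_mul, ← Int.cast_mul]
  · refine Finset.sum_congr rfl fun j _ => ?_
    have hj := j.isLt
    set e := Tuple.sort fun i => -w i with he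
    have hle : w (e ⟨j + 1, by omega⟩) ≤ w (e ⟨j, by omega⟩) :=
      le_apply_sort w (by simp [Fin.le_def])
    rcases hle.eq_or_lt with heq | hlt
    · rw [heq, sub_self]
      simp
    · have hS : ((Finset.univ.filter fun i : Fin n => (i : ℕ) ≤ (j : ℕ)).image fun i => e i) =
          Finset.univ.filter fun t => w (e ⟨j, by omega⟩) ≤ w t := by
        ext t
        obtain ⟨i, rfl⟩ := e.surjective t
        simp only [Finset.mem_image, Finset.mem_filter, Finset.mem_univ, true_and,
          EmbeddingLike.apply_eq_iff_eq, exists_eq_right]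
        refine ⟨fun h => le_apply_sort w (Fin.le_def.2 h), fun h => ?_⟩
        by_contra! hcon
        exact absurd (h.trans (le_apply_sort w (i := ⟨j + 1, by omega⟩) (Fin.le_def.2 hcon)))
          (not_le.2 hlt)
      rw [hS, hw, Int.cast_mul, EReal.coe_mul]

theorem mul_le_sq_add_halfProd (w z : ℤ) : w * z ≤ z ^ 2 + halfProd w := by
  rw [halfProd, Int.fdiv_eq_ediv_of_nonneg _ (by norm_num), Int.fdiv_eq_ediv_of_nonneg _ (by norm_num)]
  obtain ⟨k, rfl | rfl⟩ := Int.even_or_odd' w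
  · have e₁ : 2 * k / 2 = k := by omega
    have e₂ : (2 * k + 1) / 2 = k := by omega
    rw [e₁, e₂]
    nlinarith [sq_nonneg (z - k)]
  · have e₁ : (2 * k + 1) / 2 = k := by omega
    have e₂ : (2 * k + 1 + 1) / 2 = k + 1 := by omega
    rw [e₁, e₂]
    rcases le_or_gt z k with h | h
    · nlinarith
    · have h' : k + 1 ≤ z := h
      nlinarith

theorem mul_eq_sq_add_halfProd {w z : ℤ} (h₁ : 2 * z - 1 ≤ w) (h₂ : w ≤ 2 * z + 1) :
    w * z = z ^ 2 + halfProd w := by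
  rw [halfProd, Int.fdiv_eq_ediv_of_nonneg _ (by norm_num), Int.fdiv_eq_ediv_of_nonneg _ (by norm_num)]
  obtain rfl | rfl | rfl : w = 2 * z - 1 ∨ w = 2 * z ∨ w = 2 * z + 1 := by omega
  · have e₁ : (2 * z - 1) / 2 = z - 1 := by omega
    have e₂ : (2 * z - 1 + 1) / 2 = z := by omega
    rw [e₁, e₂]
    ring
  · have e₁ : 2 * z / 2 = z := by omega
    have e₂ : (2 * z + 1) / 2 = z := by omega
    rw [e₁, e₂]
    ring
  · have e₁ : (2 * z + 1) / 2 = z := by omega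
    have e₂ : (2 * z + 1 + 1) / 2 = z + 1 := by omega
    rw [e₁, e₂]
    ring

/-- For two integral base polyhedra with a common point, an integral common point of minimal
square sum together with a dual certificate for its minimality. -/
theorem exists_minimal_and_potentials {p₁ p₂ : Finset (Fin n) → EReal}
    (hsup₁ : Supermodular p₁) (hsup₂ : Supermodular p₂)
    (hint₁ : ∀ X, p₁ X = ⊥ ∨ ∃ k : ℤ, p₁ X = ((k : ℝ) : EReal))
    (hint₂ : ∀ X, p₂ X = ⊥ ∨ ∃ k : ℤ, p₂ X = ((k : ℝ) : EReal))
    (hfin₁ : p₁ Finset.univ ≠ ⊥) (hfin₂ : p₂ Finset.univ ≠ ⊥)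
    {x : Fin n → ℚ} (hx₁ : memBase p₁ x) (hx₂ : memBase p₂ x) :
    ∃ z : Fin n → ℤ, memBase p₁ (fun s => (z s : ℚ)) ∧ memBase p₂ (fun s => (z s : ℚ)) ∧
      (∀ y : Fin n → ℤ, memBase p₁ (fun s => (y s : ℚ)) → memBase p₂ (fun s => (y s : ℚ)) →
        ∑ s, (z s) ^ 2 ≤ ∑ s, (y s) ^ 2) ∧
      ∃ w₁ w₂ : Fin n → ℤ,
        (∀ s, p₁ (Finset.univ.filter fun t => w₁ s ≤ w₁ t) =
          (((∑ t with w₁ s ≤ w₁ t, z t : ℤ) : ℝ) : EReal)) ∧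
        (∀ s, p₂ (Finset.univ.filter fun t => w₂ s ≤ w₂ t) =
          (((∑ t with w₂ s ≤ w₂ t, z t : ℤ) : ℝ) : EReal)) ∧
        ∀ s, 2 * z s - 1 ≤ w₁ s + w₂ s ∧ w₁ s + w₂ s ≤ 2 * z s + 1 := by
  have hval (p : Finset (Fin n) → EReal)
      (hint : ∀ X, p X = ⊥ ∨ ∃ k : ℤ, p X = ((k : ℝ) : EReal)) :
      ∃ f : Finset (Fin n) → ℤ, ∀ X, p X ≠ ⊥ → p X = ((f X : ℝ) : EReal) := by
    have h : ∀ X, ∃ k : ℤ, p X ≠ ⊥ → p X = ((k : ℝ) : EReal) := fun X => by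
      rcases hint X with h | ⟨k, hk⟩
      · exact ⟨0, fun h' => absurd h h'⟩
      · exact ⟨k, fun _ => hk⟩
    choose f hf using h
    exact ⟨f, hf⟩
  obtain ⟨f₁, hf₁⟩ := hval p₁ hint₁
  obtain ⟨f₂, hf₂⟩ := hval p₂ hint₂
  have hs₁ := hsup₁.supermodularOn hf₁ hfin₁
  have hs₂ := hsup₂.supermodularOn hf₂ hfin₂
  simp only [memBase_iff_inBase hf₁ hfin₁, memBase_iff_inBase hf₂ hfin₂] at hx₁ hx₂ ⊢
  obtain ⟨z, hz₁, hz₂, hmin⟩ := exists_minimal_of_nonempty hs₁ hs₂ x hx₁ hx₂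
  obtain ⟨w₁, w₂, hw₁, hw₂, hw⟩ := exists_potentials_of_minimal hs₁ hs₂ z hz₁ hz₂ hmin
  exact ⟨z, hz₁, hz₂, hmin, w₁, w₂, fun s => eq_sum_of_mem_tightSets hf₁ (hw₁ s),
    fun s => eq_sum_of_mem_tightSets hf₂ (hw₂ s), hw⟩

end Lovasz

section OnlyUniv

variable {n : ℕ} {p : Finset (Fin n) → EReal}

/-- The restriction of `p` to the full ground set, with value `-∞` elsewhere. -/
noncomputable def onlyUniv (p : Finset (Fin n) → EReal) (X : Finset (Fin n)) : EReal :=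
  if X = Finset.univ then p Finset.univ else ⊥

theorem onlyUniv_univ : onlyUniv p Finset.univ = p Finset.univ := if_pos rfl

theorem supermodular_onlyUniv : Supermodular (onlyUniv p) := by
  intro X Y
  by_cases hX : X = Finset.univ
  · by_cases hY : Y = Finset.univ
    · simp [hX, hY]
    · rw [onlyUniv, onlyUniv, if_neg hY, EReal.add_bot]
      exact bot_le
  · rw [onlyUniv, if_neg hX, EReal.bot_add]
    exact bot_le

theorem onlyUniv_integral (hp : ∀ X, p X = ⊥ ∨ ∃ k : ℤ, p X = ((k : ℝ) : EReal))
    (X : Finset (Fin n)) : onlyUniv p X = ⊥ ∨ ∃ k : ℤ, onlyUniv p X = ((k : ℝ) : EReal) := by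
  rw [onlyUniv]
  split_ifs
  · exact hp _
  · exact Or.inl rfl

theorem memBase_onlyUniv {x : Fin n → ℚ} (hx : memBase p x) : memBase (onlyUniv p) x := by
  refine ⟨fun Z => ?_, by rw [onlyUniv_univ]; exact hx.2⟩
  rw [onlyUniv]
  split_ifs with h
  · exact h ▸ hx.1 Finset.univ
  · exact bot_le

end OnlyUniv

/-- For an integral base-polyhedron `B = B'(p)` with `⊙B = B ∩ ℤ^S ≠ ∅`,
`min {z² : z ∈ ⊙B} = max {p̂(w) - Σ_s ⌊w(s)/2⌋⌈w(s)/2⌉ : w ∈ ℤ^S}`; moreover, for two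
integral base-polyhedra with `B = B₁ ∩ B₂ ≠ ∅`,
`min {z² : z ∈ B ∩ ℤ^S} = max {p̂₁(w₁) + p̂₂(w₂) - Σ_s ⌊(w₁+w₂)(s)/2⌋⌈(w₁+w₂)(s)/2⌉}`. -/
theorem base_polyhedron_square_sum_minmax {n : ℕ}
    (p p₁ p₂ : Finset (Fin n) → EReal)
    (hsup : Supermodular p) (hsup₁ : Supermodular p₁) (hsup₂ : Supermodular p₂)
    (hintp : ∀ X, p X = ⊥ ∨ ∃ k : ℤ, p X = ((k : ℝ) : EReal))
    (hintp₁ : ∀ X, p₁ X = ⊥ ∨ ∃ k : ℤ, p₁ X = ((k : ℝ) : EReal))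
    (hintp₂ : ∀ X, p₂ X = ⊥ ∨ ∃ k : ℤ, p₂ X = ((k : ℝ) : EReal))
    (hfinp : ∃ k : ℤ, p Finset.univ = ((k : ℝ) : EReal))
    (hfinp₁ : ∃ k : ℤ, p₁ Finset.univ = ((k : ℝ) : EReal))
    (hfinp₂ : ∃ k : ℤ, p₂ Finset.univ = ((k : ℝ) : EReal))
    (hne : ∃ z : Fin n → ℤ, memBase p fun s => (z s : ℚ))
    (hne₁₂ : ∃ x : Fin n → ℚ, memBase p₁ x ∧ memBase p₂ x) :
    (∃ zstar : Fin n → ℤ, memBase p (fun s => (zstar s : ℚ)) ∧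
      (∀ z : Fin n → ℤ, memBase p (fun s => (z s : ℚ)) →
        ∑ s, (zstar s) ^ 2 ≤ ∑ s, (z s) ^ 2) ∧
      ∃ w : Fin n → ℤ,
        lovasz p w = (((∑ s, (zstar s) ^ 2 + ∑ s, halfProd (w s) : ℤ) : ℝ) : EReal) ∧
        ∀ w' : Fin n → ℤ,
          lovasz p w' ≤ (((∑ s, (zstar s) ^ 2 + ∑ s, halfProd (w' s) : ℤ) : ℝ) : EReal)) ∧
    (∃ zstar : Fin n → ℤ,
      memBase p₁ (fun s => (zstar s : ℚ)) ∧ memBase p₂ (fun s => (zstar s : ℚ)) ∧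
      (∀ z : Fin n → ℤ,
        memBase p₁ (fun s => (z s : ℚ)) → memBase p₂ (fun s => (z s : ℚ)) →
        ∑ s, (zstar s) ^ 2 ≤ ∑ s, (z s) ^ 2) ∧
      ∃ w₁ w₂ : Fin n → ℤ,
        lovasz p₁ w₁ + lovasz p₂ w₂ =
          (((∑ s, (zstar s) ^ 2 + ∑ s, halfProd (w₁ s + w₂ s) : ℤ) : ℝ) : EReal) ∧
        ∀ w₁' w₂' : Fin n → ℤ,
          lovasz p₁ w₁' + lovasz p₂ w₂' ≤
            (((∑ s, (zstar s) ^ 2 + ∑ s, halfProd (w₁' s + w₂' s) : ℤ) : ℝ) : EReal)) := by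
  have hbot {p : Finset (Fin n) → EReal} (h : ∃ k : ℤ, p Finset.univ = ((k : ℝ) : EReal)) :
      p Finset.univ ≠ ⊥ := by
    obtain ⟨k, hk⟩ := h
    rw [hk]
    exact EReal.coe_ne_bot _
  constructor
  · obtain ⟨y, hy⟩ := hne
    have htop := memBase_onlyUniv hy
    obtain ⟨z, hz, -, hmin, w₁, w₂, hw₁, hw₂, hw⟩ :=
      exists_minimal_and_potentials hsup supermodular_onlyUniv hintp (onlyUniv_integral hintp)
        (hbot hfinp) (by rw [onlyUniv_univ]; exact hbot hfinp) hy htop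
    refine ⟨z, hz, fun y' hy' => hmin y' hy' (memBase_onlyUniv hy'), fun s => w₁ s + w₂ s,
      ?_, fun w => ?_⟩
    · have hconst (s t : Fin n) : w₂ s ≤ w₂ t := by
        have huniv : (Finset.univ.filter fun t => w₂ s ≤ w₂ t) = Finset.univ := by
          by_contra hcon
          have := hw₂ s
          rw [onlyUniv, if_neg hcon] at this
          exact EReal.coe_ne_bot _ this.symm
        exact Finset.filter_eq_self.1 huniv t (Finset.mem_univ t)
      have hlevel (s t : Fin n) : w₁ s + w₂ s ≤ w₁ t + w₂ t ↔ w₁ s ≤ w₁ t := by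
        rw [le_antisymm (hconst s t) (hconst t s), add_le_add_iff_right]
      rw [lovasz_eq_of_level_tight hz _ fun s => by simpa only [hlevel] using hw₁ s,
        ← Finset.sum_add_distrib]
      exact congrArg (fun k : ℤ => ((k : ℝ) : EReal))
        (Finset.sum_congr rfl fun s _ => mul_eq_sq_add_halfProd (hw s).1 (hw s).2)
    · refine (lovasz_le_of_memBase hz w).trans ?_
      rw [← Finset.sum_add_distrib, EReal.coe_le_coe_iff, Int.cast_le]
      exact Finset.sum_le_sum fun s _ => mul_le_sq_add_halfProd _ _
  · obtain ⟨x, hx₁, hx₂⟩ := hne₁₂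
    obtain ⟨z, hz₁, hz₂, hmin, w₁, w₂, hw₁, hw₂, hw⟩ :=
      exists_minimal_and_potentials hsup₁ hsup₂ hintp₁ hintp₂ (hbot hfinp₁) (hbot hfinp₂) hx₁ hx₂
    refine ⟨z, hz₁, hz₂, hmin, w₁, w₂, ?_, fun w₁' w₂' => ?_⟩
    · rw [lovasz_eq_of_level_tight hz₁ _ hw₁, lovasz_eq_of_level_tight hz₂ _ hw₂,
        ← EReal.coe_add, ← Int.cast_add, ← Finset.sum_add_distrib, ← Finset.sum_add_distrib]
      exact congrArg (fun k : ℤ => ((k : ℝ) : EReal)) (Finset.sum_congr rfl fun s _ => by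
        rw [← add_mul, mul_eq_sq_add_halfProd (hw s).1 (hw s).2])
    · refine (add_le_add (lovasz_le_of_memBase hz₁ w₁') (lovasz_le_of_memBase hz₂ w₂')).trans ?_
      rw [← EReal.coe_add, ← Int.cast_add, ← Finset.sum_add_distrib, ← Finset.sum_add_distrib,
        EReal.coe_le_coe_iff, Int.cast_le]
      refine Finset.sum_le_sum fun s _ => ?_
      rw [← add_mul]
      exact mul_le_sq_add_halfProd _ _
end
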